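/- arXiv:2208.07150 — 2 statements merged into one kernel-verified Lean document; each statement's English description precedes it below -/
import Mathlib

section
/- Let (X,d,m) be an infinitesimally Hilbertian, locally uniformly doubling, strongly rectifiable metric measure space satisfying a Poincaré inequality, Ω ⊂ X open, Y_o a pointed CAT(1) space and B̄_ρ(o) a regular ball with ρ ∈ (0,π/2). Let u,v ∈ KS^{1,2}(Ω,B̄_ρ(o)), set m̂ := G^{u,v}_{1/2}, D := d_Y(u,v), 𝔡 := d_Y(m̂,o), and let η ∈ KS^{1,2}(Ω,[0,1]) be the function determined by sin((1−η)𝔡)/sin(𝔡) = cos(D/2). Then m-a.e. on Ω the following identity of energy densities holds: e_2[(1−η)𝔡]² + (cos⁴(D/2)·cos⁴(𝔡)/(1 − cos²(D/2)·sin²(𝔡)))·e_2[tan(D/2)/cos(𝔡)]² = cos²(D/2)·e_2[𝔡]² + (1/4)·e_2[D]². -/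
open MeasureTheory Metric Filter Topology Set
open scoped ENNReal NNReal

noncomputable section

namespace KSH

attribute [local instance] Classical.propDecidable

variable {X Y : Type*}

/-! ### Metric measure space basics -/

/-- The measure is finite on bounded sets. -/
def FiniteOnBounded [PseudoMetricSpace X] [MeasurableSpace X] (m : Measure X) : Prop :=
  ∀ s : Set X, Bornology.IsBounded s → m s < ⊤

/-- Locally uniformly doubling measure. -/
def LocUnifDoubling [PseudoMetricSpace X] [MeasurableSpace X] (m : Measure X) : Prop :=
  ∀ R : ℝ, 0 < R → ∃ C : ℝ≥0, 0 < C ∧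
    ∀ (x : X) (r : ℝ), 0 < r → r < R →
      m (Metric.ball x (2 * r)) ≤ (C : ℝ≥0∞) * m (Metric.ball x r)

/-- Pointwise Lipschitz constant (`ℝ≥0∞`-valued); it equals `0` at isolated points. -/
def elip [PseudoEMetricSpace X] [PseudoEMetricSpace Y] (f : X → Y) (x : X) : ℝ≥0∞ :=
  Filter.limsup (fun y => edist (f x) (f y) / edist x y) (𝓝[≠] x)

/-- A (local, uniform) Poincaré inequality. -/
def PoincareIneq [PseudoMetricSpace X] [MeasurableSpace X] (m : Measure X) : Prop :=
  ∀ R : ℝ, 0 < R → ∃ C : ℝ, 0 < C ∧ ∃ lam : ℝ, 0 < lam ∧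
    ∀ f : X → ℝ, (∃ K : ℝ≥0, LipschitzWith K f) →
      ∀ (x : X) (r : ℝ), 0 < r → r < R →
        (⨍ y in Metric.ball x r, |f y - ⨍ z in Metric.ball x r, f z ∂m| ∂m) ≤
          C * r * ⨍ y in Metric.ball x (lam * r), (elip f y).toReal ∂m

/-- `d`-dimensional strongly rectifiable space. -/
def StronglyRectifiable [MetricSpace X] [MeasurableSpace X] (m : Measure X) (d : ℕ) : Prop :=
  ∀ ε : ℝ, 0 < ε →
    ∃ (U : ℕ → Set X) (φ : ℕ → X → EuclideanSpace ℝ (Fin d)) (c : ℕ → ℝ≥0),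
      (∀ i, MeasurableSet (U i)) ∧
      Pairwise (Function.onFun Disjoint U) ∧
      m (Set.univ \ ⋃ i, U i) = 0 ∧
      ∀ i, 0 < c i ∧ Measurable (φ i) ∧
        (∀ x ∈ U i, ∀ y ∈ U i,
          dist x y ≤ (1 + ε) * dist (φ i x) (φ i y) ∧
          dist (φ i x) (φ i y) ≤ (1 + ε) * dist x y) ∧
        ((c i : ℝ≥0∞) • MeasureTheory.volume.restrict (φ i '' U i) ≤
            Measure.map (φ i) (m.restrict (U i))) ∧
        Measure.map (φ i) (m.restrict (U i)) ≤
          (ENNReal.ofReal (1 + ε) * (c i : ℝ≥0∞)) • MeasureTheory.volume.restrict (φ i '' U i)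

/-! ### Test plans, weak upper gradients, Sobolev spaces -/

/-- `S` is an upper speed for the curve `γ` on `[0,1]`. -/
def UpperSpeed [PseudoMetricSpace X] (γ : ℝ → X) (S : ℝ → ℝ) : Prop :=
  ∀ s t : ℝ, 0 ≤ s → s ≤ t → t ≤ 1 → dist (γ s) (γ t) ≤ ∫ r in s..t, S r

/-- `π` is a test plan with (upper bound for the) speed given by `S`. -/
def IsTestPlan [PseudoMetricSpace X] [MeasurableSpace X] (m : Measure X)
    (π : Measure (ℝ → X)) (S : (ℝ → X) → ℝ → ℝ) : Prop :=
  IsProbabilityMeasure π ∧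
  (∀ᵐ γ ∂π, ContinuousOn γ (Set.Icc 0 1)) ∧
  (∃ C : ℝ≥0, 0 < C ∧ ∀ t ∈ Set.Icc (0:ℝ) 1,
      Measure.map (fun γ => γ t) π ≤ (C : ℝ≥0∞) • m) ∧
  (∀ᵐ γ ∂π, UpperSpeed γ (S γ)) ∧
  (∫⁻ γ, (∫⁻ t in Set.Icc (0:ℝ) 1, ENNReal.ofReal ((S γ t) ^ 2)) ∂π) < ⊤

/-- `G` is a ($2$-)weak upper gradient of `f`. -/
def IsWUG [PseudoMetricSpace X] [MeasurableSpace X] (m : Measure X) (f G : X → ℝ) : Prop :=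
  Measurable G ∧ (∀ x, 0 ≤ G x) ∧ (∫⁻ x, ENNReal.ofReal ((G x) ^ 2) ∂m) < ⊤ ∧
  ∀ (π : Measure (ℝ → X)) (S : (ℝ → X) → ℝ → ℝ), IsTestPlan m π S →
    (∫⁻ γ, ENNReal.ofReal |f (γ 1) - f (γ 0)| ∂π) ≤
      ∫⁻ γ, (∫⁻ t in Set.Icc (0:ℝ) 1, ENNReal.ofReal (G (γ t) * S γ t)) ∂π

/-- Membership in the Sobolev space `W^{1,2}`. -/
def MemW12 [PseudoMetricSpace X] [MeasurableSpace X] (m : Measure X) (f : X → ℝ) : Prop :=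
  Measurable f ∧ (∫⁻ x, ENNReal.ofReal ((f x) ^ 2) ∂m) < ⊤ ∧ ∃ G, IsWUG m f G

/-- `G` is the minimal weak upper gradient of `f`. -/
def IsMinimalWUG [PseudoMetricSpace X] [MeasurableSpace X] (m : Measure X) (f G : X → ℝ) :
    Prop :=
  IsWUG m f G ∧ ∀ G', IsWUG m f G' → ∀ᵐ x ∂m, G x ≤ G' x

/-- Square of the `W^{1,2}` norm: `∫ f² + ∫ |Df|²` (the latter as infimum over
weak upper gradients). -/
def W12Norm2 [PseudoMetricSpace X] [MeasurableSpace X] (m : Measure X) (f : X → ℝ) : ℝ≥0∞ :=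
  (∫⁻ x, ENNReal.ofReal ((f x) ^ 2) ∂m) +
    ⨅ G : {G : X → ℝ // IsWUG m f G}, ∫⁻ x, ENNReal.ofReal ((G.1 x) ^ 2) ∂m

/-- Infinitesimal Hilbertianity: the `W^{1,2}` norm satisfies the parallelogram identity. -/
def InfHilbertian [PseudoMetricSpace X] [MeasurableSpace X] (m : Measure X) : Prop :=
  ∀ f g : X → ℝ, MemW12 m f → MemW12 m g →
    W12Norm2 m (f + g) + W12Norm2 m (f - g) = 2 * W12Norm2 m f + 2 * W12Norm2 m g

/-- The restriction of a function to a subset, as a function on the subtype. -/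
def restrFun (Ω : Set X) (f : X → ℝ) : Ω → ℝ := fun x => f x.1

/-- The measure induced on a subset. -/
def subMeasure [MeasurableSpace X] (m : Measure X) (Ω : Set X) : Measure Ω :=
  Measure.comap Subtype.val m

/-- Membership in `W^{1,2}(Ω)`. -/
def MemW12On [MetricSpace X] [MeasurableSpace X] (m : Measure X) (Ω : Set X) (f : X → ℝ) :
    Prop :=
  MemW12 (subMeasure m Ω) (restrFun Ω f)

/-- Squared `W^{1,2}(Ω)`-distance between two functions. -/
def W12DistSq [MetricSpace X] [MeasurableSpace X] (m : Measure X) (Ω : Set X) (f g : X → ℝ) :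
    ℝ≥0∞ :=
  W12Norm2 (subMeasure m Ω) (restrFun Ω f - restrFun Ω g)

/-- Membership in `W^{1,2}_0(Ω)`: the `W^{1,2}(Ω)`-closure of Sobolev functions with
support contained in `Ω`. -/
def MemW120 [MetricSpace X] [MeasurableSpace X] (m : Measure X) (Ω : Set X) (f : X → ℝ) :
    Prop :=
  MemW12On m Ω f ∧ ∀ ε : ℝ≥0∞, 0 < ε → ∃ g : X → ℝ,
    MemW12On m Ω g ∧ closure (Function.support g) ⊆ Ω ∧ W12DistSq m Ω f g < ε

/-! ### Korevaar–Schoen energies -/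

/-- Borel measurability of a map. -/
def BorelMeas [MeasurableSpace X] [TopologicalSpace Y] (u : X → Y) : Prop :=
  ∀ s : Set Y, IsOpen s → MeasurableSet (u ⁻¹' s)

section KS

variable [MetricSpace X] [MeasurableSpace X] [PseudoMetricSpace Y]

/-- The approximate energy `ks_{2,r}[u,Ω]`. -/
def ks2r (m : Measure X) (Ω : Set X) (u : X → Y) (r : ℝ) (x : X) : ℝ :=
  if Metric.ball x r ⊆ Ω then
    Real.sqrt (⨍ y in Metric.ball x r, dist (u x) (u y) ^ 2 / r ^ 2 ∂m)
  else 0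

/-- The squared approximate energy, `ℝ≥0∞`-valued. -/
def eks2r (m : Measure X) (Ω : Set X) (u : X → Y) (r : ℝ) (x : X) : ℝ≥0∞ :=
  if Metric.ball x r ⊆ Ω then
    (m (Metric.ball x r))⁻¹ *
      ∫⁻ y in Metric.ball x r, (edist (u x) (u y)) ^ 2 / (ENNReal.ofReal r) ^ 2 ∂m
  else 0

/-- The set `Ω_{v,w,α,x}` of points where `v` or `w` moves at least `α` away from its
value at `x`. -/
def badSet (Ω : Set X) (v w : X → Y) (α : ℝ) (x : X) : Set X :=
  {y ∈ Ω | α ≤ dist (v x) (v y) ∨ α ≤ dist (w x) (w y)}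

/-- The modified approximate energy `ks_{2,r}[u,Ω;v,w,α]`. -/
def ks2rMod (m : Measure X) (Ω : Set X) (u v w : X → Y) (α : ℝ) (r : ℝ) (x : X) : ℝ :=
  if Metric.ball x r ⊆ Ω then
    Real.sqrt ((m (Metric.ball x r)).toReal⁻¹ *
      ∫ y in Metric.ball x r \ badSet Ω v w α x, dist (u x) (u y) ^ 2 / r ^ 2 ∂m)
  else 0

/-- Membership in `L²(Ω, Y_o)`. -/
def MemL2 (m : Measure X) (Ω : Set X) (o : Y) (u : X → Y) : Prop :=
  BorelMeas u ∧ TopologicalSpace.IsSeparable (u '' Ω) ∧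
    (∫⁻ x in Ω, ENNReal.ofReal (dist (u x) o ^ 2) ∂m) < ⊤

/-- The Korevaar–Schoen energy `E_2^Ω(u)`. -/
def ksEnergy (m : Measure X) (Ω : Set X) (u : X → Y) : ℝ≥0∞ :=
  Filter.liminf (fun r : ℝ => ∫⁻ x in Ω, ENNReal.ofReal ((ks2r m Ω u r x) ^ 2) ∂m)
    (𝓝[>] (0:ℝ))

/-- Membership in the Korevaar–Schoen space `KS^{1,2}(Ω, Y_o)`. -/
def MemKS (m : Measure X) (Ω : Set X) (o : Y) (u : X → Y) : Prop :=
  MemL2 m Ω o u ∧ ksEnergy m Ω u < ⊤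

/-- `e` is the energy density `e_2[u]` of `u`: the approximate energies converge to it
`m`-a.e. on `Ω` and in `L²(Ω)` as `r ↓ 0`. -/
def IsEnergyDensity (m : Measure X) (Ω : Set X) (u : X → Y) (e : X → ℝ) : Prop :=
  (∀ᵐ x ∂m.restrict Ω,
    Filter.Tendsto (fun r => ks2r m Ω u r x) (𝓝[>] (0:ℝ)) (𝓝 (e x))) ∧
  Filter.Tendsto (fun r => ∫⁻ x in Ω, ENNReal.ofReal ((ks2r m Ω u r x - e x) ^ 2) ∂m)
    (𝓝[>] (0:ℝ)) (𝓝 0)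

/-- The `L²(Ω)`-distance between two maps. -/
def dL2 (m : Measure X) (Ω : Set X) (u v : X → Y) : ℝ≥0∞ :=
  (∫⁻ x in Ω, (edist (u x) (v x)) ^ 2 ∂m) ^ (1/2 : ℝ)

end KS

/-! ### Geodesics and CAT(κ) spaces -/

/-- A geodesic parametrized (proportionally to arc length) on `[0,1]`. -/
def IsGeodesic [PseudoMetricSpace Y] (γ : ℝ → Y) : Prop :=
  ∀ s ∈ Set.Icc (0:ℝ) 1, ∀ t ∈ Set.Icc (0:ℝ) 1,
    dist (γ s) (γ t) = |s - t| * dist (γ 0) (γ 1)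

/-- Every pair of points is joined by a geodesic. -/
def GeodesicSpace (Y : Type*) [PseudoMetricSpace Y] : Prop :=
  ∀ x y : Y, ∃ γ : ℝ → Y, IsGeodesic γ ∧ γ 0 = x ∧ γ 1 = y

/-- Diameter `D_κ` of the model space `M_κ`. -/
def modelDiam (κ : ℝ) : ℝ≥0∞ :=
  if 0 < κ then ENNReal.ofReal (Real.pi / Real.sqrt κ) else ⊤

/-- Inverse hyperbolic cosine. -/
def arcosh (x : ℝ) : ℝ := Real.log (x + Real.sqrt (x ^ 2 - 1))

/-- Cosine of the angle at the vertex between the sides of lengths `a` and `c` of a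
comparison triangle in `M_κ` with side lengths `a`, `b`, `c` (`b` being the side
opposite to the vertex), from the law of cosines in `M_κ`. -/
def modelCosAngle (κ a b c : ℝ) : ℝ :=
  if 0 < κ then
    (Real.cos (Real.sqrt κ * b) - Real.cos (Real.sqrt κ * a) * Real.cos (Real.sqrt κ * c)) /
      (Real.sin (Real.sqrt κ * a) * Real.sin (Real.sqrt κ * c))
  else if κ = 0 then (a ^ 2 + c ^ 2 - b ^ 2) / (2 * a * c)
  else
    (Real.cosh (Real.sqrt (-κ) * a) * Real.cosh (Real.sqrt (-κ) * c) -
        Real.cosh (Real.sqrt (-κ) * b)) /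
      (Real.sinh (Real.sqrt (-κ) * a) * Real.sinh (Real.sqrt (-κ) * c))

/-- In a comparison triangle `p̄ q̄ r̄` in `M_κ` with `d(p̄,q̄) = a`, `d(p̄,r̄) = b`,
`d(q̄,r̄) = c`, the distance from `p̄` to the point on the side `q̄ r̄` at arc length `s`
from `q̄`. -/
def modelDist (κ a b c s : ℝ) : ℝ :=
  if 0 < κ then
    (1 / Real.sqrt κ) *
      Real.arccos (Real.cos (Real.sqrt κ * a) * Real.cos (Real.sqrt κ * s) +
        Real.sin (Real.sqrt κ * a) * Real.sin (Real.sqrt κ * s) * modelCosAngle κ a b c)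
  else if κ = 0 then
    Real.sqrt (a ^ 2 + s ^ 2 - 2 * a * s * modelCosAngle κ a b c)
  else
    (1 / Real.sqrt (-κ)) *
      arcosh (Real.cosh (Real.sqrt (-κ) * a) * Real.cosh (Real.sqrt (-κ) * s) -
        Real.sinh (Real.sqrt (-κ) * a) * Real.sinh (Real.sqrt (-κ) * s) * modelCosAngle κ a b c)

/-- `Y` is a CAT(κ) space: a complete geodesic space in which every (nondegenerate)
geodesic triangle of perimeter `< 2 D_κ` is at least as thin as its comparison triangle
in the model space `M_κ`. -/
def IsCAT (κ : ℝ) (Y : Type*) [MetricSpace Y] : Prop :=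
  GeodesicSpace Y ∧
  ∀ (p : Y) (γ : ℝ → Y), IsGeodesic γ →
    0 < dist p (γ 0) → 0 < dist (γ 0) (γ 1) →
    ENNReal.ofReal (dist p (γ 0) + dist p (γ 1) + dist (γ 0) (γ 1)) < 2 * modelDiam κ →
    ∀ t ∈ Set.Icc (0:ℝ) 1,
      dist p (γ t) ≤
        modelDist κ (dist p (γ 0)) (dist p (γ 1)) (dist (γ 0) (γ 1))
          (t * dist (γ 0) (γ 1))

/-- `mid` is the midpoint of a geodesic from `a` to `b`. -/
def IsGeodMidpoint [PseudoMetricSpace Y] (a b mid : Y) : Prop :=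
  ∃ γ : ℝ → Y, IsGeodesic γ ∧ γ 0 = a ∧ γ 1 = b ∧ γ (1/2) = mid

/-- `p` is the point at parameter `t` on a geodesic from `a` to `b`. -/
def IsGeodInterp [PseudoMetricSpace Y] (a b : Y) (t : ℝ) (p : Y) : Prop :=
  ∃ γ : ℝ → Y, IsGeodesic γ ∧ γ 0 = a ∧ γ 1 = b ∧ γ t = p

/-! ### The Dirichlet energy functional -/

/-- `u` belongs to `KS^{1,2}_{ū}(Ω, T)`: a Korevaar–Schoen map with values in `T`
whose "boundary value" agrees with that of `ū`. -/
def KSuSetIn [MetricSpace X] [MeasurableSpace X] [PseudoMetricSpace Y]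
    (m : Measure X) (Ω : Set X) (o : Y) (T : Set Y) (ubar u : X → Y) : Prop :=
  (∀ x ∈ Ω, u x ∈ T) ∧ MemKS m Ω o u ∧
    MemW120 m Ω (fun x => dist (u x) (ubar x))

/-- The functional `E^Ω_{2,ū}` (equal to the energy on `KS^{1,2}_{ū}` and `+∞` elsewhere). -/
def EFunIn [MetricSpace X] [MeasurableSpace X] [PseudoMetricSpace Y]
    (m : Measure X) (Ω : Set X) (o : Y) (T : Set Y) (ubar u : X → Y) : ℝ≥0∞ :=
  if KSuSetIn m Ω o T ubar u then ksEnergy m Ω u else ⊤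



lemma ks2r_congr {Z : Type*} [MetricSpace X] [MeasurableSpace X] [OpensMeasurableSpace X] [PseudoMetricSpace Z]
    (m : Measure X) (Ω : Set X)
    {f g : X → Z} (h : ∀ x ∈ Ω, f x = g x) {r : ℝ} (hr : 0 < r) (x : X) :
    ks2r m Ω f r x = ks2r m Ω g r x := by
  unfold ks2r
  split_ifs with hb
  · congr 1
    rw [setAverage_eq, setAverage_eq]
    congr 1
    apply setIntegral_congr_fun measurableSet_ball
    intro y hy
    simp only
    rw [h x (hb (mem_ball_self hr)), h y (hb hy)]
  · rfl

lemma IsEnergyDensity.congr' {Z : Type*} [MetricSpace X] [MeasurableSpace X] [OpensMeasurableSpace X]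
    [PseudoMetricSpace Z]
    {m : Measure X} {Ω : Set X} {e : X → ℝ}
    {f g : X → Z} (he : IsEnergyDensity m Ω f e) (h : ∀ x ∈ Ω, f x = g x) :
    IsEnergyDensity m Ω g e := by
  have hE : ∀ᶠ r : ℝ in 𝓝[>] (0:ℝ), ∀ x, ks2r m Ω f r x = ks2r m Ω g r x := by
    filter_upwards [self_mem_nhdsWithin] with r hr x using ks2r_congr m Ω h hr x
  refine ⟨?_, ?_⟩
  · filter_upwards [he.1] with x hx
    exact hx.congr' (hE.mono fun r hr => hr x)
  · refine he.2.congr' (hE.mono fun r hr => ?_)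
    simp only [hr]

lemma cat_mid {Y : Type*} [MetricSpace Y] (hY : IsCAT 1 Y) (p a b q : Y)
    (hq : IsGeodMidpoint a b q) (hab : dist a b < Real.pi)
    (hper : dist p a + dist p b + dist a b < 2 * Real.pi) :
    dist p q ≤ Real.arccos ((Real.cos (dist p a) + Real.cos (dist p b)) /
      (2 * Real.cos (dist a b / 2))) := by
  obtain ⟨γ, hγ, rfl, rfl, rfl⟩ := hq
  have hh : (1/2:ℝ) ∈ Set.Icc (0:ℝ) 1 := by constructor <;> norm_num
  have h0 : (0:ℝ) ∈ Set.Icc (0:ℝ) 1 := by constructor <;> norm_num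
  have hc0 : 0 ≤ dist (γ 0) (γ 1) := dist_nonneg
  have hcos : 0 < Real.cos (dist (γ 0) (γ 1) / 2) :=
    Real.cos_pos_of_mem_Ioo ⟨by linarith [Real.pi_pos], by linarith⟩
  have hcc : Real.cos (dist (γ 0) (γ 1)) = 2 * Real.cos (dist (γ 0) (γ 1) / 2) ^ 2 - 1 := by
    rw [← Real.cos_two_mul]; congr 1; ring
  have h12 := hγ 0 h0 (1/2) hh
  rcases eq_or_lt_of_le hc0 with h | hc
  · rw [← h] at h12
    have e1 : γ 0 = γ 1 := dist_eq_zero.1 h.symm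
    have e2 : γ 0 = γ (1/2) := dist_eq_zero.1 (by simpa using h12)
    rw [← e2, ← e1]
    rw [← e1] at hper
    simp only [dist_self] at hper ⊢
    rw [show (Real.cos (dist p (γ 0)) + Real.cos (dist p (γ 0))) / (2 * Real.cos (0/2)) =
      Real.cos (dist p (γ 0)) by simp]
    rw [Real.arccos_cos dist_nonneg (by linarith)]
  rcases eq_or_lt_of_le (dist_nonneg (x := p) (y := γ 0)) with h | hp
  · have e1 : p = γ 0 := dist_eq_zero.1 h.symm
    subst e1
    rw [h12, dist_self, Real.cos_zero, hcc]
    rw [show (1 + (2 * Real.cos (dist (γ 0) (γ 1) / 2) ^ 2 - 1)) /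
      (2 * Real.cos (dist (γ 0) (γ 1) / 2)) = Real.cos (dist (γ 0) (γ 1) / 2) by field_simp; ring]
    rw [Real.arccos_cos (by linarith) (by linarith)]
    norm_num
    linarith
  · have := hY.2 p γ hγ hp hc ?_ (1/2) hh
    · refine this.trans (le_of_eq ?_)
      unfold modelDist modelCosAngle
      simp only [zero_lt_one, if_true, Real.sqrt_one, one_mul, div_one]
      congr 1
      have t1 := dist_triangle_left (γ 0) (γ 1) p
      have t2 := dist_triangle (p) (γ 1) (γ 0)
      rw [dist_comm (γ 1) (γ 0)] at t2
      have s1 : 0 < Real.sin (dist p (γ 0)) := Real.sin_pos_of_pos_of_lt_pi hp (by linarith)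
      have s2 : 0 < Real.sin (dist (γ 0) (γ 1) / 2) :=
        Real.sin_pos_of_pos_of_lt_pi (by linarith) (by linarith)
      have hss : Real.sin (dist (γ 0) (γ 1)) =
          2 * Real.sin (dist (γ 0) (γ 1) / 2) * Real.cos (dist (γ 0) (γ 1) / 2) := by
        rw [← Real.sin_two_mul]; congr 1; ring
      rw [hss, hcc, show (1/2 * dist (γ 0) (γ 1)) = dist (γ 0) (γ 1) / 2 by ring]
      field_simp
      ring
    · unfold modelDiam
      simp only [zero_lt_one, if_true, Real.sqrt_one, div_one]
      rw [show (2:ℝ≥0∞) = ENNReal.ofReal 2 by simp, ← ENNReal.ofReal_mul (by norm_num)]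
      exact (ENNReal.ofReal_lt_ofReal_iff (by positivity)).2 hper

lemma cat_mid_ball {Y : Type*} [MetricSpace Y] (hY : IsCAT 1 Y) {o a b q : Y} {ρ : ℝ}
    (hρ : ρ ∈ Set.Ioo 0 (Real.pi / 2)) (ha : a ∈ closedBall o ρ) (hb : b ∈ closedBall o ρ)
    (hq : IsGeodMidpoint a b q) : dist q o ≤ ρ := by
  rw [mem_closedBall'] at ha hb
  have hab : dist a b ≤ 2 * ρ := by linarith [dist_triangle_left a b o]
  obtain ⟨h1, h2⟩ := hρ
  have := cat_mid hY o a b q hq (by linarith) (by linarith)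
  rw [dist_comm]
  refine this.trans ?_
  have hcos : 0 < Real.cos (dist a b / 2) :=
    Real.cos_pos_of_mem_Ioo ⟨by linarith [Real.pi_pos, dist_nonneg (x := a) (y := b)], by linarith⟩
  have c1 : Real.cos ρ ≤ Real.cos (dist o a) :=
    Real.cos_le_cos_of_nonneg_of_le_pi dist_nonneg (by linarith) ha
  have c2 : Real.cos ρ ≤ Real.cos (dist o b) :=
    Real.cos_le_cos_of_nonneg_of_le_pi dist_nonneg (by linarith) hb
  have c3 : 0 < Real.cos ρ := Real.cos_pos_of_mem_Ioo ⟨by linarith, by linarith⟩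
  calc _ ≤ Real.arccos (Real.cos ρ) := by
        apply Real.antitone_arccos
        rw [le_div_iff₀ (by positivity)]
        nlinarith [Real.cos_le_one (dist a b / 2)]
    _ = ρ := Real.arccos_cos h1.le (by linarith)

lemma cat_mid_cont {Y : Type*} [MetricSpace Y] (hY : IsCAT 1 Y) (o : Y) {ρ : ℝ}
    (hρ : ρ ∈ Set.Ioo 0 (Real.pi / 2)) (S : Set Y) (hS : S ⊆ closedBall o ρ)
    (q : S × S → Y) (hq : ∀ z, IsGeodMidpoint (z.1 : Y) (z.2 : Y) (q z)) : Continuous q := by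
  rw [continuous_iff_continuousAt]
  intro z
  have hlt : ∀ w : S × S, dist (w.1 : Y) (w.2 : Y) < Real.pi := by
    intro w
    have h1 := hS w.1.2
    have h2 := hS w.2.2
    rw [mem_closedBall'] at h1 h2
    linarith [dist_triangle_left (w.1 : Y) w.2 o, hρ.2]
  have hd : dist (q z) (z.1 : Y) = dist (z.1:Y) (z.2 : Y) / 2 ∧
      dist (q z) (z.2 : Y) = dist (z.1:Y) (z.2 : Y) / 2 := by
    obtain ⟨γ, hγ, h0, h1, h2⟩ := hq z
    have a1 := hγ (1/2) ⟨by norm_num, by norm_num⟩ 0 ⟨by norm_num, by norm_num⟩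
    have a2 := hγ (1/2) ⟨by norm_num, by norm_num⟩ 1 ⟨by norm_num, by norm_num⟩
    rw [h0, h1, h2] at a1 a2
    norm_num at a1 a2
    constructor <;> linarith
  have hcos : 0 < Real.cos (dist (z.1:Y) (z.2 : Y) / 2) :=
    Real.cos_pos_of_mem_Ioo ⟨by linarith [Real.pi_pos, dist_nonneg (x := (z.1:Y)) (y := z.2)],
      by linarith [hlt z]⟩
  let g : S × S → ℝ := fun w => Real.arccos ((Real.cos (dist (q z) (w.1:Y)) +
      Real.cos (dist (q z) (w.2:Y))) / (2 * Real.cos (dist (w.1:Y) (w.2:Y) / 2)))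
  have hg : ContinuousAt g z := by
    apply Real.continuous_arccos.continuousAt.comp
    apply ContinuousAt.div
    · fun_prop
    · fun_prop
    · positivity
  have hgz : g z = 0 := by
    simp only [g, hd.1, hd.2]
    rw [← two_mul, div_self (by positivity), Real.arccos_one]
  have hper : ∀ᶠ w : S × S in 𝓝 z, dist (q z) (w.1:Y) + dist (q z) (w.2:Y) +
      dist (w.1:Y) (w.2:Y) < 2 * Real.pi := by
    have : ContinuousAt (fun w : S × S => dist (q z) (w.1:Y) + dist (q z) (w.2:Y) +
      dist (w.1:Y) (w.2:Y)) z := by fun_prop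
    apply this.eventually_lt_const
    show dist (q z) (z.1:Y) + dist (q z) (z.2:Y) + dist (z.1:Y) (z.2:Y) < 2 * Real.pi
    rw [hd.1, hd.2]
    linarith [hlt z]
  rw [ContinuousAt, tendsto_iff_dist_tendsto_zero]
  have hg' : Tendsto g (𝓝 z) (𝓝 0) := by rw [← hgz]; exact hg
  refine squeeze_zero' (Eventually.of_forall fun _ => dist_nonneg) ?_ hg'
  filter_upwards [hper] with w hw
  rw [dist_comm]
  exact cat_mid hY (q z) w.1 w.2 (q w) (hq w) (hlt w) hw

def FA (z : ℝ × ℝ) : ℝ := Real.arcsin (Real.cos (z.2 / 2) * Real.sin z.1)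
def FB (z : ℝ × ℝ) : ℝ := Real.tan (z.2 / 2) / Real.cos z.1
def QQ (z : ℝ × ℝ) : ℝ := Real.cos (z.2 / 2) ^ 4 * Real.cos z.1 ^ 4 /
              (1 - Real.cos (z.2 / 2) ^ 2 * Real.sin z.1 ^ 2)
def HH (z w : ℝ × ℝ) : ℝ := (FA z - FA w) ^ 2 + QQ z * (FB z - FB w) ^ 2
    - (Real.cos (z.2 / 2) ^ 2 * (z.1 - w.1) ^ 2 + (1/4) * (z.2 - w.2) ^ 2)

lemma sq_lin_bound {a l ε N : ℝ} (hε : 0 ≤ ε) (hN : 0 ≤ N) (h : |a - l| ≤ ε * N)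
    {L : ℝ} (hl : |l| ≤ L * N) : |a ^ 2 - l ^ 2| ≤ ε * (ε + 2 * L) * N ^ 2 := by
  have h1 : a ^ 2 - l ^ 2 = (a - l) * ((a - l) + 2 * l) := by ring
  rw [h1, abs_mul]
  have h2 : |(a - l) + 2 * l| ≤ ε * N + 2 * (L * N) := by
    refine (abs_add_le _ _).trans ?_
    rw [abs_mul, abs_two]; gcongr
  calc _ ≤ (ε * N) * (ε * N + 2 * (L * N)) := by gcongr
    _ = _ := by ring

lemma FA_deriv (z : ℝ × ℝ) {c s C S q : ℝ} (hc : c = Real.cos (z.2 / 2)) (hs : s = Real.sin (z.2 / 2))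
    (hC : C = Real.cos z.1) (hS : S = Real.sin z.1) (hlt : (c * S) ^ 2 < 1)
    (hq : q = Real.sqrt (1 - (c * S) ^ 2)) :
    ∃ A' : ℝ × ℝ →L[ℝ] ℝ, HasFDerivAt FA A' z ∧
      ∀ v, A' v = (c * C * v.1 - s * S / 2 * v.2) / q := by
  have h1 : HasFDerivAt (fun w : ℝ × ℝ => w.1) (ContinuousLinearMap.fst ℝ ℝ ℝ) z := hasFDerivAt_fst
  have h2 : HasFDerivAt (fun w : ℝ × ℝ => w.2) (ContinuousLinearMap.snd ℝ ℝ ℝ) z := hasFDerivAt_snd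
  have h3 := (h2.mul_const (2⁻¹ : ℝ)).cos
  have h4 := h3.mul h1.sin
  have h0 := (Real.hasDerivAt_arcsin (x := c * S) (by nlinarith) (by nlinarith))
  rw [hc, hS] at h0
  have h5 := HasDerivAt.comp_hasFDerivAt z h0 h4
  refine ⟨_, h5, fun v => ?_⟩
  rw [hq, hc, hs, hC, hS]
  simp [div_eq_mul_inv]
  ring

lemma FB_deriv (z : ℝ × ℝ) {c s C S : ℝ} (hc : c = Real.cos (z.2 / 2)) (hs : s = Real.sin (z.2 / 2))
    (hC : C = Real.cos z.1) (hS : S = Real.sin z.1) (hc0 : 0 < c) (hC0 : 0 < C) :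
    ∃ B' : ℝ × ℝ →L[ℝ] ℝ, HasFDerivAt FB B' z ∧
      ∀ v, B' v = v.2 / (2 * c ^ 2 * C) + s * S / (c * C ^ 2) * v.1 := by
  have h1 : HasFDerivAt (fun w : ℝ × ℝ => w.1) (ContinuousLinearMap.fst ℝ ℝ ℝ) z := hasFDerivAt_fst
  have h2 : HasFDerivAt (fun w : ℝ × ℝ => w.2) (ContinuousLinearMap.snd ℝ ℝ ℝ) z := hasFDerivAt_snd
  have h3 := (h2.mul_const (2⁻¹ : ℝ))
  have ht := Real.hasDerivAt_tan (x := z.2 * 2⁻¹) (by rw [← div_eq_mul_inv, ← hc]; exact hc0.ne')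
  have h4 := HasDerivAt.comp_hasFDerivAt z ht h3
  have hi := hasDerivAt_inv (x := Real.cos z.1) (by rw [← hC]; exact hC0.ne')
  have h5 := HasDerivAt.comp_hasFDerivAt z hi h1.cos
  have h6 := h4.mul h5
  refine ⟨_, h6, fun v => ?_⟩
  simp [← div_eq_mul_inv, ← hC, ← hS, ← hc, Real.tan_eq_sin_div_cos, ← hs]
  field_simp
  ring

lemma key_alg {c s C S q a b : ℝ} (hc0 : 0 < c) (hC0 : 0 < C) (hq0 : 0 < q)
    (hCS : S ^ 2 = 1 - C ^ 2) (hcs : s ^ 2 = 1 - c ^ 2) (hq2 : q ^ 2 = 1 - c ^ 2 * S ^ 2) :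
    ((c * C * a - s * S / 2 * b) / q) ^ 2 + c ^ 4 * C ^ 4 / q ^ 2 *
      (b / (2 * c ^ 2 * C) + s * S / (c * C ^ 2) * a) ^ 2 = c ^ 2 * a ^ 2 + 1/4 * b ^ 2 := by
  have e1 : (b / (2 * c ^ 2 * C) + s * S / (c * C ^ 2) * a) =
      (C * b / 2 + c * s * S * a) / (c ^ 2 * C ^ 2) := by field_simp
  rw [e1]
  have e2 : (c * C * a - s * S / 2 * b) ^ 2 + (C * b / 2 + c * s * S * a) ^ 2 =
      q ^ 2 * (c ^ 2 * a ^ 2 + 1/4 * b ^ 2) := by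
    rw [hq2]
    have : (c * C * a - s * S / 2 * b) ^ 2 + (C * b / 2 + c * s * S * a) ^ 2
        = (C ^ 2 + s ^ 2 * S ^ 2) * (c ^ 2 * a ^ 2 + 1/4 * b ^ 2) := by ring
    rw [this, hcs, hCS]; ring
  have e3 : c ^ 4 * C ^ 4 / q ^ 2 * ((C * b / 2 + c * s * S * a) / (c ^ 2 * C ^ 2)) ^ 2 =
      (C * b / 2 + c * s * S * a) ^ 2 / q ^ 2 := by
    field_simp
  rw [e3, div_pow, ← add_div, e2]
  field_simp

set_option maxHeartbeats 1000000 in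
lemma HH_bound {ρ : ℝ} (hρ : ρ ∈ Set.Ioo 0 (Real.pi / 2)) (z : ℝ × ℝ)
    (hz1 : z.1 ∈ Icc 0 ρ) (hz2 : z.2 ∈ Icc 0 (2 * ρ)) {ε : ℝ} (hε : 0 < ε) :
    ∃ K : ℝ, 0 ≤ K ∧ ∀ w : ℝ × ℝ, w.1 ∈ Icc 0 ρ → w.2 ∈ Icc 0 (2 * ρ) →
      |HH z w| ≤ ε * ((z.1 - w.1) ^ 2 + (z.2 - w.2) ^ 2)
        + K * (|z.1 - w.1| ^ 3 + |z.2 - w.2| ^ 3) := by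
  obtain ⟨hρ0, hρ1⟩ := hρ
  have cpos : ∀ t ∈ Icc 0 ρ, Real.cos ρ ≤ Real.cos t := fun t ht =>
    Real.cos_le_cos_of_nonneg_of_le_pi ht.1 (by linarith) ht.2
  have cρ : 0 < Real.cos ρ := Real.cos_pos_of_mem_Ioo ⟨by linarith, by linarith⟩
  have hz2' : z.2 / 2 ∈ Icc 0 ρ := ⟨by linarith [hz2.1], by linarith [hz2.2]⟩
  set C := Real.cos z.1 with hC
  set S := Real.sin z.1 with hS
  set c := Real.cos (z.2 / 2) with hc
  set s := Real.sin (z.2 / 2) with hs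
  have hC0 : 0 < C := cρ.trans_le (cpos _ hz1)
  have hc0 : 0 < c := cρ.trans_le (cpos _ hz2')
  have hCS : S ^ 2 = 1 - C ^ 2 := by rw [hS, hC, Real.sin_sq]
  have hcs : s ^ 2 = 1 - c ^ 2 := by rw [hs, hc, Real.sin_sq]
  have hP : 0 < 1 - c ^ 2 * S ^ 2 := by
    have : c ^ 2 * S ^ 2 < 1 := by
      rw [hCS]
      have : c ^ 2 ≤ 1 := by nlinarith [sq_nonneg s]
      nlinarith [sq_pos_of_pos hc0, sq_pos_of_pos hC0]
    linarith
  set q := Real.sqrt (1 - (c * S) ^ 2) with hq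
  have hq2 : q ^ 2 = 1 - c ^ 2 * S ^ 2 := by
    rw [hq, Real.sq_sqrt (by nlinarith)]; ring
  have hq0 : 0 < q := Real.sqrt_pos.2 (by nlinarith)
  have hQ : QQ z = c ^ 4 * C ^ 4 / (1 - c ^ 2 * S ^ 2) := rfl
  have hQ0 : 0 ≤ QQ z := by rw [hQ]; positivity
  obtain ⟨A', hA', hAv⟩ := FA_deriv z hc hs hC hS (by nlinarith) hq
  obtain ⟨B', hB', hBv⟩ := FB_deriv z hc hs hC hS hc0 hC0
  have key : ∀ v : ℝ × ℝ, (A' v) ^ 2 + QQ z * (B' v) ^ 2 = c ^ 2 * v.1 ^ 2 + 1/4 * v.2 ^ 2 := by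
    intro v
    rw [hAv, hBv, hQ, ← hq2]
    exact key_alg hc0 hC0 hq0 hCS hcs hq2
  -- bounds
  set L := ‖A'‖ + ‖B'‖ with hL
  have hL0 : 0 ≤ L := by positivity
  obtain ⟨ε', hε'0, hε'⟩ : ∃ ε' : ℝ, 0 < ε' ∧ (1 + QQ z) * (ε' * (ε' + 2 * L)) ≤ ε := by
    have : Tendsto (fun t : ℝ => (1 + QQ z) * (t * (t + 2 * L))) (𝓝[>] 0) (𝓝 0) := by
      have h : Continuous (fun t : ℝ => (1 + QQ z) * (t * (t + 2 * L))) := by fun_prop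
      have := h.tendsto 0
      simp only [zero_mul, mul_zero] at this
      exact this.mono_left nhdsWithin_le_nhds
    obtain ⟨t, h1, h2⟩ := ((this.eventually_le_const hε).and self_mem_nhdsWithin).exists
    exact ⟨t, h2, h1⟩
  have hAo := (hasFDerivAt_iff_isLittleO.1 hA').def hε'0
  have hBo := (hasFDerivAt_iff_isLittleO.1 hB').def hε'0
  obtain ⟨τ, hτ0, hτ⟩ := Metric.eventually_nhds_iff.1 (hAo.and hBo)
  -- global bound of HH
  obtain ⟨M, hM0, hM⟩ : ∃ M : ℝ, 0 ≤ M ∧ ∀ w : ℝ × ℝ, w.1 ∈ Icc 0 ρ → w.2 ∈ Icc 0 (2 * ρ) →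
      |HH z w| ≤ M := by
    have hFA : ∀ w, |FA w| ≤ Real.pi / 2 := fun w =>
      abs_le.2 ⟨Real.neg_pi_div_two_le_arcsin _, Real.arcsin_le_pi_div_two _⟩
    have hFB : ∀ w : ℝ × ℝ, w.1 ∈ Icc 0 ρ → w.2 ∈ Icc 0 (2 * ρ) → 
        |FB w| ≤ 1 / Real.cos ρ / Real.cos ρ := by
      intro w h1 h2
      have c1 := cpos _ h1
      have c2 := cpos (w.2 / 2) ⟨by linarith [h2.1], by linarith [h2.2]⟩
      have p1 := cρ.trans_le c1
      have p2 := cρ.trans_le c2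
      unfold FB
      rw [Real.tan_eq_sin_div_cos, abs_div, abs_div, abs_of_pos p1, abs_of_pos p2]
      have := Real.abs_sin_le_one (w.2/2)
      gcongr
    have sqb : ∀ {a b N : ℝ}, |a| ≤ N → |b| ≤ N → (a - b) ^ 2 ≤ 4 * N ^ 2 := by
      intro a b N h1 h2
      rw [show 4 * N ^ 2 = (2 * N) ^ 2 by ring]
      apply sq_le_sq'
      · linarith [abs_le.1 h1, abs_le.1 h2]
      · linarith [abs_le.1 h1, abs_le.1 h2]
    refine ⟨4 * (Real.pi/2) ^ 2 + QQ z * (4 * (1 / Real.cos ρ / Real.cos ρ) ^ 2) + 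
      (c ^ 2 * (4 * (2 * ρ) ^ 2) + 1/4 * (4 * (2 * ρ) ^ 2)), by positivity, fun w h1 h2 => ?_⟩
    have b1 := sqb (hFA z) (hFA w)
    have b2 := sqb (hFB z hz1 hz2) (hFB w h1 h2)
    have b3 : (z.1 - w.1) ^ 2 ≤ 4 * (2 * ρ) ^ 2 := sqb (abs_le.2 ⟨by linarith [hz1.1], by linarith [hz1.2]⟩)
      (abs_le.2 ⟨by linarith [h1.1], by linarith [h1.2]⟩)
    have b4 : (z.2 - w.2) ^ 2 ≤ 4 * (2 * ρ) ^ 2 := sqb (abs_le.2 ⟨by linarith [hz2.1], by linarith [hz2.2]⟩)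
      (abs_le.2 ⟨by linarith [h2.1], by linarith [h2.2]⟩)
    unfold HH
    rw [← hc]
    have d2 := mul_le_mul_of_nonneg_left b2 hQ0
    have d3 := mul_le_mul_of_nonneg_left b3 (sq_nonneg c)
    have d2' := mul_nonneg hQ0 (sq_nonneg (FB z - FB w))
    have d3' := mul_nonneg (sq_nonneg c) (sq_nonneg (z.1 - w.1))
    rw [abs_le]
    constructor <;> nlinarith [sq_nonneg (FA z - FA w), sq_nonneg (z.2 - w.2)]
  refine ⟨M / τ ^ 3, by positivity, fun w h1 h2 => ?_⟩
  have hn : ‖w - z‖ = max |z.1 - w.1| |z.2 - w.2| := by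
    rw [Prod.norm_def, Prod.fst_sub, Prod.snd_sub, Real.norm_eq_abs, Real.norm_eq_abs, abs_sub_comm, abs_sub_comm w.2]
  by_cases hw : dist w z < τ
  · obtain ⟨ha, hb⟩ := hτ hw
    rw [Real.norm_eq_abs] at ha hb
    have hA2 := sq_lin_bound (L := L) hε'0.le (norm_nonneg _) ha (by
      refine (A'.le_opNorm _).trans ?_
      gcongr
      rw [hL]; linarith [norm_nonneg B'])
    have hB2 := sq_lin_bound (L := L) hε'0.le (norm_nonneg _) hb (by
      refine (B'.le_opNorm _).trans ?_
      gcongr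
      rw [hL]; linarith [norm_nonneg A'])
    have hk := key (w - z)
    have hHH : HH z w = ((FA w - FA z) ^ 2 - (A' (w - z)) ^ 2) + 
        QQ z * ((FB w - FB z) ^ 2 - (B' (w - z)) ^ 2) := by
      unfold HH
      rw [Prod.fst_sub, Prod.snd_sub] at hk
      linear_combination hk
    have hN2 : ‖w - z‖ ^ 2 ≤ (z.1 - w.1) ^ 2 + (z.2 - w.2) ^ 2 := by
      rw [hn]
      rcases max_choice |z.1 - w.1| |z.2 - w.2| with h | h <;> rw [h, sq_abs] <;> nlinarith [sq_nonneg (z.1 - w.1), sq_nonneg (z.2 - w.2)]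
    have : |HH z w| ≤ ε * ((z.1 - w.1) ^ 2 + (z.2 - w.2) ^ 2) := by
      rw [hHH]
      calc _ ≤ abs ((FA w - FA z) ^ 2 - (A' (w - z)) ^ 2) +
            QQ z * abs ((FB w - FB z) ^ 2 - (B' (w - z)) ^ 2) := by
              refine (abs_add_le _ _).trans ?_
              rw [abs_mul, abs_of_nonneg hQ0]
        _ ≤ ε' * (ε' + 2 * L) * ‖w - z‖ ^ 2 + QQ z * (ε' * (ε' + 2 * L) * ‖w - z‖ ^ 2) := by gcongr
        _ = ((1 + QQ z) * (ε' * (ε' + 2 * L))) * ‖w - z‖ ^ 2 := by ring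
        _ ≤ ε * ((z.1 - w.1) ^ 2 + (z.2 - w.2) ^ 2) := by gcongr
    have : 0 ≤ M / τ ^ 3 * (|z.1 - w.1| ^ 3 + |z.2 - w.2| ^ 3) := by positivity
    linarith
  · push Not at hw
    rw [dist_eq_norm, hn] at hw
    have h3 : τ ^ 3 ≤ |z.1 - w.1| ^ 3 + |z.2 - w.2| ^ 3 := by
      have p1 : 0 ≤ |z.1 - w.1| ^ 3 := by positivity
      have p2 : 0 ≤ |z.2 - w.2| ^ 3 := by positivity
      rcases le_max_iff.1 hw with h | h
      · have := pow_le_pow_left₀ hτ0.le h 3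
        linarith
      · have := pow_le_pow_left₀ hτ0.le h 3
        linarith
    have : M ≤ M / τ ^ 3 * (|z.1 - w.1| ^ 3 + |z.2 - w.2| ^ 3) := by
      rw [div_mul_eq_mul_div, le_div_iff₀ (by positivity)]
      gcongr
    have := hM w h1 h2
    have : 0 ≤ ε * ((z.1 - w.1) ^ 2 + (z.2 - w.2) ^ 2) := by positivity
    linarith

section main
set_option linter.unusedSectionVars false
variable [MetricSpace X] [TopologicalSpace.SeparableSpace X] [MeasurableSpace X] [BorelSpace X]

lemma meas_ball_pos {m : Measure X} (hdoub : LocUnifDoubling m) (hm : m ≠ 0) (x : X) {r : ℝ}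
    (hr : 0 < r) : 0 < m (ball x r) := by
  rw [pos_iff_ne_zero]
  intro h0
  apply hm
  have : ∀ k : ℕ, m (ball x (2 ^ k * r)) = 0 := by
    intro k
    induction k with
    | zero => simpa using h0
    | succ k ih =>
      obtain ⟨C, hC, h⟩ := hdoub (2 ^ k * r + 1) (by positivity)
      have := h x (2 ^ k * r) (by positivity) (by linarith)
      rw [ih, mul_zero] at this
      rw [show (2:ℝ) ^ (k+1) * r = 2 * (2 ^ k * r) by ring]
      exact le_antisymm this (zero_le)
  rw [← Measure.measure_univ_eq_zero]
  refine measure_mono_null ?_ (measure_iUnion_null this)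
  intro y _
  rw [mem_iUnion]
  obtain ⟨k, hk⟩ := pow_unbounded_of_one_lt (dist y x / r) (one_lt_two)
  exact ⟨k, by rw [mem_ball]; rwa [div_lt_iff₀ hr] at hk⟩

lemma ks2r_nonneg {m : Measure X} {Ω : Set X} (f : X → ℝ) (r : ℝ) (x : X) :
    0 ≤ ks2r m Ω f r x := by
  unfold ks2r; split_ifs
  · exact Real.sqrt_nonneg _
  · exact le_rfl

lemma bdd_sq {f : X → ℝ} {M : ℝ} (hM : ∀ x, |f x| ≤ M) (x y : X) : |f x - f y| ≤ 2 * M := by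
  refine (abs_sub _ _).trans ?_
  linarith [hM x, hM y]

lemma integrableOn_sq {m : Measure X} (hfin : FiniteOnBounded m) {f : X → ℝ} (hf : Measurable f)
    {M : ℝ} (hM : ∀ x, |f x| ≤ M) (x a : X) (r : ℝ) (k : ℕ) :
    IntegrableOn (fun y => |f x - f y| ^ k) (ball a r) m := by
  refine Measure.integrableOn_of_bounded (M := (2 * M) ^ k) (hfin _ isBounded_ball).ne ?_ ?_
  · exact (by fun_prop : Measurable fun y => |f x - f y| ^ k).aestronglyMeasurable
  · refine Eventually.of_forall fun y => ?_
    rw [Real.norm_eq_abs, abs_of_nonneg (by positivity)]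
    exact pow_le_pow_left₀ (abs_nonneg _) (bdd_sq hM x y) k

lemma ks_sq_real {m : Measure X} (hfin : FiniteOnBounded m) (hdoub : LocUnifDoubling m)
    (hm : m ≠ 0) {Ω : Set X} {f : X → ℝ} {r : ℝ} (hr : 0 < r) {x : X}
    (hb : ball x r ⊆ Ω) :
    ks2r m Ω f r x ^ 2 * r ^ 2 * m.real (ball x r) = ∫ y in ball x r, |f x - f y| ^ 2 ∂m := by
  unfold ks2r
  rw [if_pos hb, Real.sq_sqrt, setAverage_eq, smul_eq_mul]
  · have h1 : 0 < m.real (ball x r) :=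
      ENNReal.toReal_pos (meas_ball_pos hdoub hm x hr).ne' (hfin _ isBounded_ball).ne
    rw [integral_div]
    simp only [Real.dist_eq]
    field_simp
  · rw [setAverage_eq, smul_eq_mul]
    apply mul_nonneg (by positivity)
    apply integral_nonneg
    intro y; positivity

lemma ks_sq_enn {m : Measure X} (hfin : FiniteOnBounded m) (hdoub : LocUnifDoubling m)
    (hm : m ≠ 0) {Ω : Set X} {f : X → ℝ} (hf : Measurable f)
    {M : ℝ} (hM : ∀ x, |f x| ≤ M) {r : ℝ} (hr : 0 < r) {x : X}
    (hb : ball x r ⊆ Ω) :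
    (m (ball x r))⁻¹ * ∫⁻ y in ball x r, ENNReal.ofReal (|f x - f y| ^ 2 / r ^ 2) ∂m
      = ENNReal.ofReal (ks2r m Ω f r x ^ 2) := by
  have h := ks_sq_real (f := f) hfin hdoub hm hr hb
  have hi := (integrableOn_sq hfin hf hM x x r 2).div_const (r ^ 2)
  rw [← ofReal_integral_eq_lintegral_ofReal hi
    (Eventually.of_forall fun y => by positivity), integral_div, ← h]
  have h1 : 0 < m.real (ball x r) :=
      ENNReal.toReal_pos (meas_ball_pos hdoub hm x hr).ne' (hfin _ isBounded_ball).ne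
  have h2 : m (ball x r) = ENNReal.ofReal (m.real (ball x r)) :=
    (ENNReal.ofReal_toReal (hfin _ isBounded_ball).ne).symm
  rw [h2, ← ENNReal.ofReal_inv_of_pos h1, ← ENNReal.ofReal_mul (by positivity)]
  congr 1
  field_simp

lemma meas_ball_fun (m : Measure X) [SFinite m] (r : ℝ) : Measurable (fun x => m (ball x r)) := by
  have : MeasurableSet {p : X × X | dist p.2 p.1 < r} :=
    (isOpen_lt (by fun_prop) (by fun_prop)).measurableSet
  exact measurable_measure_prodMk_left this

lemma meas_sub (Ω : Set X) (r : ℝ) : MeasurableSet {x : X | ball x r ⊆ Ω} := by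
  have : {x : X | ball x r ⊆ Ω} = (⋃ y ∈ Ωᶜ, ball y r)ᶜ := by
    ext x
    simp only [mem_ofPred_eq, mem_compl_iff, mem_iUnion, not_exists, mem_ball, subset_def]
    constructor
    · intro h y hy hd
      exact hy (h y (by rwa [dist_comm]))
    · intro h y hd
      by_contra hy
      exact h y hy (by rwa [dist_comm])
  rw [this]
  exact (isOpen_biUnion fun y _ => isOpen_ball).measurableSet.compl

lemma meas_ks (m : Measure X) [SFinite m] (Ω : Set X) {f : X → ℝ} (hf : Measurable f) (r : ℝ) :
    Measurable (ks2r m Ω f r) := by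
  unfold ks2r
  refine Measurable.ite (meas_sub Ω r) ?_ measurable_const
  apply Measurable.sqrt
  simp only [setAverage_eq, smul_eq_mul]
  refine Measurable.mul ?_ ?_
  · exact (meas_ball_fun m r).ennreal_toReal.inv
  · have hS : MeasurableSet {p : X × X | dist p.2 p.1 < r} :=
      (isOpen_lt (by fun_prop) (by fun_prop)).measurableSet
    have hg : Measurable (Set.indicator {p : X × X | dist p.2 p.1 < r}
        (fun p => dist (f p.1) (f p.2) ^ 2 / r ^ 2)) := by
      refine Measurable.indicator ?_ hS
      fun_prop
    have := hg.stronglyMeasurable.integral_prod_right' (ν := m)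
    convert this.measurable using 1
    ext x
    rw [← integral_indicator measurableSet_ball]
    rfl

lemma pt_bound {m : Measure X} (hfin : FiniteOnBounded m) (hdoub : LocUnifDoubling m)
    (hm : m ≠ 0) {Ω : Set X} {f : X → ℝ} (hf : Measurable f)
    {M : ℝ} (hM : ∀ x, |f x| ≤ M) {C : ℝ≥0}
    (hC : ∀ (x : X) (r : ℝ), 0 < r → r < 1 →
      m (Metric.ball x (2 * r)) ≤ (C : ℝ≥0∞) * m (Metric.ball x r))
    {r : ℝ} (hr : 0 < r) (hr1 : r < 1/2) {x y : X} (hb : ball x (4 * r) ⊆ Ω) (hxy : dist x y < r) :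
    |f x - f y| ≤ (3 + 3 * C) * r * (ks2r m Ω f r x + ks2r m Ω f (2 * r) y) := by
  have hCr : ∀ (x : X) (r : ℝ), 0 < r → r < 1 → m.real (ball x (2 * r)) ≤ C * m.real (ball x r) := by
    intro x r h1 h2
    have := ENNReal.toReal_mono (ENNReal.mul_ne_top ENNReal.coe_ne_top (hfin _ isBounded_ball).ne)
      (hC x r h1 h2)
    simpa [ENNReal.toReal_mul, Measure.real] using this
  have hV : 0 < m.real (ball x r) :=
      ENNReal.toReal_pos (meas_ball_pos hdoub hm x hr).ne' (hfin _ isBounded_ball).ne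
  have hbx : ball x r ⊆ Ω := (ball_subset_ball (by linarith)).trans hb
  have hby : ball y (2 * r) ⊆ Ω := (ball_subset_ball' (by rw [dist_comm]; linarith)).trans hb
  have k1 := ks_sq_real (f := f) hfin hdoub hm hr hbx
  have k2 := ks_sq_real (f := f) hfin hdoub hm (by linarith : 0 < 2 * r) hby
  have hsub : ball x r ⊆ ball y (2 * r) := ball_subset_ball' (by linarith)
  have hvol : m.real (ball y (2 * r)) ≤ C * (C * m.real (ball x r)) := by
    calc _ ≤ m.real (ball x (2 * (2 * r))) :=
          measureReal_mono (ball_subset_ball' (by rw [dist_comm]; linarith)) (hfin _ isBounded_ball).ne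
      _ ≤ C * m.real (ball x (2 * r)) := hCr _ _ (by linarith) (by linarith)
      _ ≤ _ := by gcongr; exact hCr _ _ hr (by linarith)
  set a := ks2r m Ω f r x with ha
  set b := ks2r m Ω f (2 * r) y with hb'
  have ha0 : 0 ≤ a := ks2r_nonneg _ _ _
  have hb0 : 0 ≤ b := ks2r_nonneg _ _ _
  have i1 := integrableOn_sq hfin hf hM x x r 2
  have i2 := integrableOn_sq hfin hf hM y x r 2
  have i3 := integrableOn_sq hfin hf hM y y (2 * r) 2
  have main : |f x - f y| ^ 2 * m.real (ball x r) ≤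
      2 * (a ^ 2 * r ^ 2 * m.real (ball x r)) + 2 * (b ^ 2 * (2 * r) ^ 2 * m.real (ball y (2 * r))) := by
    calc |f x - f y| ^ 2 * m.real (ball x r) = ∫ z in ball x r, |f x - f y| ^ 2 ∂m := by
          rw [setIntegral_const, smul_eq_mul, mul_comm]
      _ ≤ ∫ z in ball x r, (2 * |f x - f z| ^ 2 + 2 * |f y - f z| ^ 2) ∂m := by
          apply integral_mono
          · exact integrableOn_const (hfin _ isBounded_ball).ne
          · exact (i1.const_mul 2).add (i2.const_mul 2)
          · intro z
            simp only [sq_abs]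
            nlinarith [sq_nonneg (f x - f z + (f y - f z))]
      _ = 2 * (∫ z in ball x r, |f x - f z| ^ 2 ∂m) + 2 * ∫ z in ball x r, |f y - f z| ^ 2 ∂m := by
          rw [integral_add (i1.const_mul 2) (i2.const_mul 2), integral_const_mul, integral_const_mul]
      _ ≤ _ := by
          rw [k1, k2]
          gcongr
          · exact Eventually.of_forall fun z => by positivity
  have : |f x - f y| ^ 2 ≤ 2 * (a ^ 2 * r ^ 2) + 8 * (b ^ 2 * r ^ 2 * C ^ 2) := by
    refine le_of_mul_le_mul_right ?_ hV
    refine main.trans ?_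
    have := mul_le_mul_of_nonneg_left hvol (by positivity : 0 ≤ 8 * (b ^ 2 * r ^ 2))
    nlinarith
  have hC0 : (0:ℝ) ≤ C := C.2
  refine abs_le_of_sq_le_sq ?_ (by positivity)
  rw [← sq_abs]
  refine this.trans ?_
  have e : ((3 + 3 * C) * r * (a + b)) ^ 2 = (9 * (1 + C) ^ 2 * (a + b) ^ 2) * r ^ 2 := by ring
  rw [e, show 2 * (a ^ 2 * r ^ 2) + 8 * (b ^ 2 * r ^ 2 * C ^ 2) = (2 * a ^ 2 + 8 * (b ^ 2 * C ^ 2)) * r ^ 2 by ring]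
  gcongr
  have h1 : a ^ 2 ≤ (a + b) ^ 2 := by gcongr; linarith
  have h2 : b ^ 2 ≤ (a + b) ^ 2 := by gcongr; linarith
  have h3 : b ^ 2 * C ^ 2 ≤ (a + b) ^ 2 * C ^ 2 := by gcongr
  have h4 : (0:ℝ) ≤ C * (a + b) ^ 2 := by positivity
  have h5 : (0:ℝ) ≤ C ^ 2 * (a + b) ^ 2 := by positivity
  nlinarith [sq_nonneg (a + b)]

def TT (m : Measure X) (f : X → ℝ) (r : ℝ) (x : X) : ℝ≥0∞ :=
  (m (ball x r))⁻¹ * ∫⁻ y in ball x r, ENNReal.ofReal (|f x - f y| ^ 3 / r ^ 2) ∂m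

def ZZ (Ω : Set X) (x0 : X) (R r : ℝ) : Set X := {x | x ∈ ball x0 R ∧ ball x (4 * r) ⊆ Ω}

def WW (m : Measure X) (Ω : Set X) (f : X → ℝ) (M K r : ℝ) (x : X) : ℝ :=
  min (2 * M) (K * r * (ks2r m Ω f r x + ks2r m Ω f (2 * r) x))

lemma meas_ZZ (Ω : Set X) (x0 : X) (R r : ℝ) : MeasurableSet (ZZ Ω x0 R r) :=
  measurableSet_ball.inter (meas_sub Ω (4 * r))

lemma meas_WW (m : Measure X) [SFinite m] (Ω : Set X) {f : X → ℝ} (hf : Measurable f) (M K r : ℝ) :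
    Measurable (WW m Ω f M K r) := by
  unfold WW
  have h1 := meas_ks m Ω hf r
  have h2 := meas_ks m Ω hf (2 * r)
  fun_prop

lemma meas_TT (m : Measure X) [SFinite m] {f : X → ℝ} (hf : Measurable f) (r : ℝ) :
    Measurable (TT m f r) := by
  unfold TT
  refine (meas_ball_fun m r).inv.mul ?_
  have hS : MeasurableSet {p : X × X | dist p.2 p.1 < r} :=
      (isOpen_lt (by fun_prop) (by fun_prop)).measurableSet
  have hg : Measurable (Set.indicator {p : X × X | dist p.2 p.1 < r}
        (fun p => ENNReal.ofReal (|f p.1 - f p.2| ^ 3 / r ^ 2))) := by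
      refine Measurable.indicator ?_ hS
      fun_prop
  have := hg.lintegral_prod_right' (ν := m)
  convert this using 1
  ext x
  rw [← lintegral_indicator measurableSet_ball]
  rfl

lemma step1 {m : Measure X} [SFinite m] (hfin : FiniteOnBounded m) (hdoub : LocUnifDoubling m)
    (hm : m ≠ 0) {Ω : Set X} {f : X → ℝ} (hf : Measurable f)
    {M : ℝ} (hM : ∀ x, |f x| ≤ M) {C : ℝ≥0}
    (hC : ∀ (x : X) (r : ℝ), 0 < r → r < 1 →
      m (Metric.ball x (2 * r)) ≤ (C : ℝ≥0∞) * m (Metric.ball x r))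
    {r : ℝ} (hr : 0 < r) (hr1 : r < 1/2) (x0 : X) (R : ℝ) (hΩ : MeasurableSet Ω) :
    ∫⁻ x in ZZ Ω x0 R r, TT m f r x ∂m ≤ (1 + C) * ∫⁻ x in Ω ∩ ball x0 (R + 1),
      ENNReal.ofReal (WW m Ω f M (3 + 3 * C) r x) * ENNReal.ofReal (ks2r m Ω f r x ^ 2) ∂m := by
  set W := WW m Ω f M (3 + 3 * C) r with hW
  have hWm : Measurable W := meas_WW _ _ hf _ _ _
  have hkm := meas_ks m Ω hf r
  have hM0 : 0 ≤ M := (abs_nonneg _).trans (hM x0)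
  have hW0 : ∀ x, 0 ≤ W x := by
    intro x
    refine le_min (by linarith) ?_
    have := ks2r_nonneg (m := m) (Ω := Ω) f r x
    have := ks2r_nonneg (m := m) (Ω := Ω) f (2 * r) x
    positivity
  let q : X → X → ℝ≥0∞ := fun x y => ENNReal.ofReal (|f x - f y| ^ 2 / r ^ 2)
  have hq : ∀ x y, q x y = q y x := fun x y => by simp only [q]; rw [abs_sub_comm]
  have hqm : Measurable (Function.uncurry q) := by
    simp only [q, Function.uncurry_def]; fun_prop
  have hδ : ∀ x ∈ ZZ Ω x0 R r, ∀ y ∈ ball x r, ENNReal.ofReal (|f x - f y| ^ 3 / r ^ 2) ≤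
      ENNReal.ofReal (W x) * q x y + ENNReal.ofReal (W y) * q x y := by
    intro x hx y hy
    have h1 := pt_bound hfin hdoub hm hf hM hC hr hr1 hx.2 (by rwa [dist_comm] : dist x y < r)
    have h2 := bdd_sq hM x y
    have a1 := ks2r_nonneg (m := m) (Ω := Ω) f r x
    have a2 := ks2r_nonneg (m := m) (Ω := Ω) f (2 * r) x
    have a3 := ks2r_nonneg (m := m) (Ω := Ω) f r y
    have a4 := ks2r_nonneg (m := m) (Ω := Ω) f (2 * r) y
    have h3 : |f x - f y| ≤ W x + W y := by
      rcases le_total (2 * M) ((3 + 3 * C) * r * (ks2r m Ω f r x + ks2r m Ω f (2 * r) x)) with h | h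
      · have : W x = 2 * M := min_eq_left h
        linarith [hW0 y]
      rcases le_total (2 * M) ((3 + 3 * C) * r * (ks2r m Ω f r y + ks2r m Ω f (2 * r) y)) with h' | h'
      · have : W y = 2 * M := min_eq_left h'
        linarith [hW0 x]
      have e1 : W x = _ := min_eq_right h
      have e2 : W y = _ := min_eq_right h'
      rw [e1, e2, ← mul_add]
      refine h1.trans ?_
      gcongr <;> linarith
    simp only [q]
    rw [← add_mul, ← ENNReal.ofReal_add (hW0 x) (hW0 y), ← ENNReal.ofReal_mul (by linarith [hW0 x, hW0 y])]
    apply ENNReal.ofReal_le_ofReal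
    rw [pow_succ, mul_comm, mul_div_assoc]
    gcongr
  have hball : ∀ x ∈ ZZ Ω x0 R r, ball x r ⊆ Ω := fun x hx =>
    (ball_subset_ball (by linarith)).trans hx.2
  have hTT : ∀ x ∈ ZZ Ω x0 R r, TT m f r x ≤
      ENNReal.ofReal (W x) * ENNReal.ofReal (ks2r m Ω f r x ^ 2) +
      ∫⁻ y in ball x r, (m (ball x r))⁻¹ * (ENNReal.ofReal (W y) * q x y) ∂m := by
    intro x hx
    unfold TT
    rw [← ks_sq_enn hfin hdoub hm hf hM hr (hball x hx)]
    have hqx : Measurable (q x) := hqm.of_uncurry_left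
    calc _ ≤ (m (ball x r))⁻¹ * ∫⁻ y in ball x r, (ENNReal.ofReal (W x) * q x y + ENNReal.ofReal (W y) * q x y) ∂m := by
          exact mul_le_mul_right (setLIntegral_mono' measurableSet_ball (hδ x hx)) _
      _ = _ := by
          rw [lintegral_add_left (hqx.const_mul _), lintegral_const_mul _ hqx, lintegral_const_mul _ (by fun_prop), mul_add]
          congr 1
          ring
  have hsub : ZZ Ω x0 R r ⊆ Ω ∩ ball x0 (R + 1) := fun x hx =>
    ⟨hball x hx (mem_ball_self hr), ball_subset_ball (by linarith) hx.1⟩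
  have hsecond : ∫⁻ x in ZZ Ω x0 R r, ∫⁻ y in ball x r, (m (ball x r))⁻¹ * (ENNReal.ofReal (W y) * q x y) ∂m ∂m
      ≤ C * ∫⁻ x in Ω ∩ ball x0 (R + 1), ENNReal.ofReal (W x) * ENNReal.ofReal (ks2r m Ω f r x ^ 2) ∂m := by
    let g : X → X → ℝ≥0∞ := fun x y => Set.indicator {p : X × X | p.1 ∈ ZZ Ω x0 R r ∧ dist p.2 p.1 < r}
      (fun p => (m (ball p.1 r))⁻¹ * (ENNReal.ofReal (W p.2) * q p.1 p.2)) (x, y)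
    have hgm : Measurable (Function.uncurry g) := by
      have hS : MeasurableSet {p : X × X | p.1 ∈ ZZ Ω x0 R r ∧ dist p.2 p.1 < r} :=
        (measurable_fst (meas_ZZ Ω x0 R r)).inter
        ((isOpen_lt (by fun_prop) (by fun_prop)).measurableSet :
          MeasurableSet {p : X × X | dist p.2 p.1 < r})
      have h1 : Measurable (fun p : X × X => (m (ball p.1 r))⁻¹) :=
        ((meas_ball_fun m r).comp measurable_fst).inv
      have h2 : Measurable (fun p : X × X => q p.1 p.2) := hqm
      exact Measurable.indicator (by fun_prop) hS
    have e1 : ∫⁻ x in ZZ Ω x0 R r, ∫⁻ y in ball x r, (m (ball x r))⁻¹ * (ENNReal.ofReal (W y) * q x y) ∂m ∂m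
        = ∫⁻ x, ∫⁻ y, g x y ∂m ∂m := by
      rw [← lintegral_indicator (meas_ZZ Ω x0 R r)]
      congr 1
      ext x
      by_cases hx : x ∈ ZZ Ω x0 R r
      · rw [indicator_of_mem hx, ← lintegral_indicator measurableSet_ball]
        congr 1
        ext y
        by_cases hy : dist y x < r
        · simp [g, indicator, hx, hy]
        · simp [g, indicator, hy]
      · simp [g, indicator, hx]
    rw [e1, lintegral_lintegral_swap hgm.aemeasurable, ← lintegral_const_mul _ (by fun_prop),
      ← lintegral_indicator (hΩ.inter measurableSet_ball)]
    apply lintegral_mono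
    intro y
    show ∫⁻ x, g x y ∂m ≤ _
    by_cases hy : ∃ x ∈ ZZ Ω x0 R r, dist y x < r
    · obtain ⟨x, hx, hxy⟩ := hy
      have hby : ball y r ⊆ Ω := (ball_subset_ball' (by linarith)).trans hx.2
      have hyB : y ∈ Ω ∩ ball x0 (R + 1) := ⟨hby (mem_ball_self hr), by
        have := hx.1
        rw [mem_ball] at this ⊢
        linarith [dist_triangle y x x0]⟩
      rw [indicator_of_mem hyB, ← ks_sq_enn hfin hdoub hm hf hM hr hby]
      have hqy : Measurable (q y) := hqm.of_uncurry_left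
      have : ∀ x, g x y ≤ Set.indicator (ball y r)
          (fun x => (C * (m (ball y r))⁻¹ * ENNReal.ofReal (W y)) * q y x) x := by
        intro x
        by_cases hx : x ∈ ZZ Ω x0 R r ∧ dist y x < r
        · have hx' : x ∈ ball y r := by rw [mem_ball, dist_comm]; exact hx.2
          rw [indicator_of_mem hx']
          simp only [g, indicator, mem_ofPred_eq, hx, and_self, if_true]
          rw [hq x y, ← mul_assoc]
          gcongr
          have hle : m (ball y r) ≤ C * m (ball x r) :=
            (measure_mono (ball_subset_ball' (by linarith [hx.2]))).trans (hC x r hr (by linarith))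
          have hy0 := (meas_ball_pos hdoub hm y hr).ne'
          have hx0 := (meas_ball_pos hdoub hm x hr).ne'
          have hyt := (hfin _ (isBounded_ball (x := y) (r := r))).ne
          have hxt := (hfin _ (isBounded_ball (x := x) (r := r))).ne
          rw [← div_eq_mul_inv, ENNReal.le_div_iff_mul_le (Or.inl hy0) (Or.inl hyt), mul_comm,
            ← div_eq_mul_inv]
          exact ENNReal.div_le_of_le_mul hle
        · simp only [g, indicator, mem_ofPred_eq, hx, if_false]
          exact zero_le
      refine (lintegral_mono this).trans ?_
      rw [lintegral_indicator measurableSet_ball, lintegral_const_mul _ hqy]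
      apply le_of_eq
      ring
    · have : ∀ x, g x y = 0 := by
        intro x
        have : ¬ (x ∈ ZZ Ω x0 R r ∧ dist y x < r) := fun h => hy ⟨x, h.1, h.2⟩
        simp only [g, indicator, mem_ofPred_eq, this, if_false]
      simp [this]
  calc _ ≤ ∫⁻ x in ZZ Ω x0 R r, (ENNReal.ofReal (W x) * ENNReal.ofReal (ks2r m Ω f r x ^ 2) +
      ∫⁻ y in ball x r, (m (ball x r))⁻¹ * (ENNReal.ofReal (W y) * q x y) ∂m) ∂m :=
        setLIntegral_mono' (meas_ZZ Ω x0 R r) hTT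
    _ = ∫⁻ x in ZZ Ω x0 R r, ENNReal.ofReal (W x) * ENNReal.ofReal (ks2r m Ω f r x ^ 2) ∂m + 
        ∫⁻ x in ZZ Ω x0 R r, ∫⁻ y in ball x r, (m (ball x r))⁻¹ * (ENNReal.ofReal (W y) * q x y) ∂m ∂m := 
        lintegral_add_left (by fun_prop) _
    _ ≤ _ := by
        rw [add_mul, one_mul]
        exact add_le_add (lintegral_mono_set hsub) hsecond

lemma step2 {m : Measure X} [SFinite m] (hfin : FiniteOnBounded m)
    {Ω : Set X} {f : X → ℝ} (hf : Measurable f)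
    {M : ℝ} (hM : ∀ x, |f x| ≤ M) {e : X → ℝ} (he : IsEnergyDensity m Ω f e)
    {K : ℝ} (hK : 0 ≤ K) {r : ℕ → ℝ} (hr : ∀ n, 0 < r n) (hr0 : Tendsto r atTop (𝓝 0))
    (x0 : X) (R : ℝ) :
    Tendsto (fun n => ∫⁻ x in Ω ∩ ball x0 R,
      ENNReal.ofReal (WW m Ω f M K (r n) x) * ENNReal.ofReal (ks2r m Ω f (r n) x ^ 2) ∂m)
      atTop (𝓝 0) := by
  have hM0 : 0 ≤ M := (abs_nonneg _).trans (hM x0)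
  have hr' : Tendsto r atTop (𝓝[>] 0) :=
    tendsto_nhdsWithin_iff.2 ⟨hr0, Eventually.of_forall hr⟩
  have hr2 : Tendsto (fun n => 2 * r n) atTop (𝓝[>] 0) := by
    refine tendsto_nhdsWithin_iff.2 ⟨by simpa using hr0.const_mul 2, Eventually.of_forall fun n => ?_⟩
    have := hr n
    simp only [mem_Ioi]; linarith
  set μ := m.restrict (Ω ∩ ball x0 R) with hμ
  have hle : μ ≤ m.restrict Ω := Measure.restrict_mono inter_subset_left le_rfl
  have hae : ∀ᵐ x ∂μ, Tendsto (fun r => ks2r m Ω f r x) (𝓝[>] (0:ℝ)) (𝓝 (e x)) :=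
    ae_mono hle he.1
  have hkm := fun n => meas_ks m Ω hf (r n)
  have hem : AEMeasurable e μ :=
    aemeasurable_of_tendsto_metrizable_ae atTop (fun n => (hkm n).aemeasurable)
      (hae.mono fun x hx => hx.comp hr')
  have hL2 : Tendsto (fun n => ∫⁻ x, ENNReal.ofReal ((ks2r m Ω f (r n) x - e x) ^ 2) ∂μ) atTop (𝓝 0) := by
    refine tendsto_of_tendsto_of_tendsto_of_le_of_le tendsto_const_nhds (he.2.comp hr')
      (fun _ => zero_le) (fun n => ?_)
    exact lintegral_mono' hle le_rfl
  have hsq : ∀ a b : ℝ, ENNReal.ofReal (a ^ 2) ≤ 2 * ENNReal.ofReal ((a - b) ^ 2) + 2 * ENNReal.ofReal (b ^ 2) := by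
    intro a b
    rw [show (2:ℝ≥0∞) = ENNReal.ofReal 2 by simp, ← ENNReal.ofReal_mul (by norm_num),
      ← ENNReal.ofReal_mul (by norm_num), ← ENNReal.ofReal_add (by positivity) (by positivity)]
    apply ENNReal.ofReal_le_ofReal
    nlinarith [sq_nonneg (a - b - b)]
  have hμfin : IsFiniteMeasure μ := ⟨by
    rw [hμ, Measure.restrict_apply_univ]
    exact (measure_mono inter_subset_right).trans_lt (hfin _ isBounded_ball)⟩
  -- e is square integrable
  have he2 : ∫⁻ x, ENNReal.ofReal (e x ^ 2) ∂μ ≠ ⊤ := by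
    obtain ⟨n, hn⟩ := (hL2.eventually_lt_const (zero_lt_one (α := ℝ≥0∞))).exists
    have hb : ∀ x, ks2r m Ω f (r n) x ^ 2 ≤ (2 * M / r n) ^ 2 := by
      intro x
      have hrn := hr n
      unfold ks2r
      split_ifs
      · rw [Real.sq_sqrt (by
          rw [setAverage_eq]
          exact smul_nonneg (by positivity) (integral_nonneg fun y => by positivity))]
        rw [setAverage_eq, smul_eq_mul]
        have h1 : ∫ y in ball x (r n), dist (f x) (f y) ^ 2 / r n ^ 2 ∂m ≤
            m.real (ball x (r n)) * (2 * M / r n) ^ 2 := by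
          have := norm_setIntegral_le_of_norm_le_const (μ := m) (s := ball x (r n))
            (f := fun y => dist (f x) (f y) ^ 2 / r n ^ 2) (C := (2 * M / r n) ^ 2)
            (hfin _ isBounded_ball) (fun y _ => by
              rw [Real.norm_of_nonneg (by positivity), div_pow, Real.dist_eq]
              gcongr
              exact bdd_sq hM x y)
          rw [mul_comm]
          exact (le_abs_self _).trans this
        calc _ ≤ (m.real (ball x (r n)))⁻¹ * (m.real (ball x (r n)) * (2 * M / r n) ^ 2) := by
              gcongr
          _ = ((m.real (ball x (r n)))⁻¹ * m.real (ball x (r n))) * (2 * M / r n) ^ 2 := by ring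
          _ ≤ 1 * (2 * M / r n) ^ 2 := by
              gcongr
              exact inv_mul_le_one
          _ = _ := one_mul _
      · rw [zero_pow two_ne_zero]; exact sq_nonneg _
    have h3 : ∫⁻ x, ENNReal.ofReal (e x ^ 2) ∂μ ≤
        ∫⁻ x, (2 * ENNReal.ofReal ((2 * M / r n) ^ 2) + 2 * ENNReal.ofReal ((ks2r m Ω f (r n) x - e x) ^ 2)) ∂μ := by
      apply lintegral_mono
      intro x
      have := hsq (e x) (ks2r m Ω f (r n) x)
      rw [show (e x - ks2r m Ω f (r n) x) ^ 2 = (ks2r m Ω f (r n) x - e x) ^ 2 by ring, add_comm] at this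
      refine this.trans ?_
      have h5 := ENNReal.ofReal_le_ofReal (hb x)
      show _ ≤ 2 * ENNReal.ofReal ((2 * M / r n) ^ 2) + 2 * ENNReal.ofReal ((ks2r m Ω f (r n) x - e x) ^ 2)
      gcongr
    refine ne_top_of_le_ne_top ?_ h3
    rw [lintegral_add_left measurable_const, lintegral_const, lintegral_const_mul' _ _ (by simp)]
    refine ENNReal.add_ne_top.2 ⟨?_, ?_⟩
    · exact ENNReal.mul_ne_top (ENNReal.mul_ne_top (by simp) ENNReal.ofReal_ne_top) (measure_ne_top _ _)
    · exact ENNReal.mul_ne_top (by simp) (hn.trans ENNReal.one_lt_top).ne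
  have hDCT : Tendsto (fun n => ∫⁻ x, ENNReal.ofReal (WW m Ω f M K (r n) x) * ENNReal.ofReal (e x ^ 2) ∂μ)
      atTop (𝓝 0) := by
    have : (0:ℝ≥0∞) = ∫⁻ x, 0 ∂μ := by simp
    rw [this]
    refine tendsto_lintegral_of_dominated_convergence' (fun x => ENNReal.ofReal (2 * M) * ENNReal.ofReal (e x ^ 2))
      (fun n => ?_) (fun n => ?_) ?_ ?_
    · have := meas_WW m Ω hf M K (r n)
      exact (this.ennreal_ofReal.aemeasurable).mul (hem.pow_const 2).ennreal_ofReal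
    · refine Eventually.of_forall fun x => ?_
      simp only
      gcongr
      exact min_le_left _ _
    · rw [lintegral_const_mul' _ _ ENNReal.ofReal_ne_top]
      exact ENNReal.mul_ne_top ENNReal.ofReal_ne_top he2
    · filter_upwards [hae] with x hx
      have h1 := hx.comp hr'
      have h2 := hx.comp hr2
      have h3 : Tendsto (fun n => WW m Ω f M K (r n) x) atTop (𝓝 0) := by
        have h4 : Tendsto (fun n => K * r n * (ks2r m Ω f (r n) x + ks2r m Ω f (2 * r n) x)) atTop
            (𝓝 (K * 0 * (e x + e x))) := (hr0.const_mul K).mul (h1.add h2)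
        have h5 := (tendsto_const_nhds (x := 2 * M)).min h4
        rw [mul_zero, zero_mul, min_eq_right (by linarith)] at h5
        exact h5
      have h6 := ENNReal.Tendsto.mul_const (b := ENNReal.ofReal (e x ^ 2))
        (ENNReal.tendsto_ofReal h3) (Or.inr ENNReal.ofReal_ne_top)
      simpa using h6
  have hlim : Tendsto (fun n => ENNReal.ofReal (2 * M) * (2 * ∫⁻ x, ENNReal.ofReal ((ks2r m Ω f (r n) x - e x) ^ 2) ∂μ)
      + 2 * ∫⁻ x, ENNReal.ofReal (WW m Ω f M K (r n) x) * ENNReal.ofReal (e x ^ 2) ∂μ) atTop (𝓝 0) := by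
    have a1 := ENNReal.Tendsto.const_mul (a := ENNReal.ofReal (2 * M))
      (ENNReal.Tendsto.const_mul (a := 2) hL2 (Or.inr (by simp))) (Or.inr ENNReal.ofReal_ne_top)
    have a2 := ENNReal.Tendsto.const_mul (a := 2) hDCT (Or.inr (by simp))
    simpa using a1.add a2
  refine tendsto_of_tendsto_of_tendsto_of_le_of_le tendsto_const_nhds hlim
      (fun _ => zero_le) (fun n => ?_)
  simp only
  have hWm := meas_WW m Ω hf M K (r n)
  rw [← lintegral_const_mul' _ _ (by simp), ← lintegral_const_mul' _ _ ENNReal.ofReal_ne_top,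
    ← lintegral_const_mul' _ _ (by simp), ← lintegral_add_left']
  · apply lintegral_mono
    intro x
    simp only
    calc _ ≤ ENNReal.ofReal (WW m Ω f M K (r n) x) * (2 * ENNReal.ofReal ((ks2r m Ω f (r n) x - e x) ^ 2) + 2 * ENNReal.ofReal (e x ^ 2)) := by
          gcongr
          exact hsq _ _
      _ = ENNReal.ofReal (WW m Ω f M K (r n) x) * (2 * ENNReal.ofReal ((ks2r m Ω f (r n) x - e x) ^ 2)) +
          2 * (ENNReal.ofReal (WW m Ω f M K (r n) x) * ENNReal.ofReal (e x ^ 2)) := by ring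
      _ ≤ _ := by
          gcongr
          exact min_le_left _ _
  · exact (((((hkm n).aemeasurable.sub hem).pow_const 2).ennreal_ofReal).const_mul 2).const_mul _

lemma step3 {m : Measure X} [SFinite m] (hfin : FiniteOnBounded m) (hdoub : LocUnifDoubling m)
    (hm : m ≠ 0) {Ω : Set X} (hΩ : IsOpen Ω) {f : X → ℝ} (hf : Measurable f)
    {M : ℝ} (hM : ∀ x, |f x| ≤ M) {e : X → ℝ} (he : IsEnergyDensity m Ω f e)
    {r : ℕ → ℝ} (hr : ∀ n, 0 < r n) (hr1 : ∀ n, r n < 1/2) (hr0 : Tendsto r atTop (𝓝 0))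
    (x0 : X) (R : ℝ) :
    Tendsto (fun n => ∫⁻ x in ZZ Ω x0 R (r n), TT m f (r n) x ∂m) atTop (𝓝 0) := by
  obtain ⟨C, _, hC⟩ := hdoub 1 one_pos
  have h2 := step2 hfin hf hM he (K := 3 + 3 * C) (by positivity) hr hr0 x0 (R + 1)
  have h3 := ENNReal.Tendsto.const_mul (a := 1 + (C : ℝ≥0∞)) h2 (Or.inr (by simp))
  rw [mul_zero] at h3
  exact tendsto_of_tendsto_of_tendsto_of_le_of_le tendsto_const_nhds h3
      (fun _ => zero_le) (fun n => step1 hfin hdoub hm hf hM hC (hr n) (hr1 n) x0 R hΩ.measurableSet)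

lemma step4 {m : Measure X} [SFinite m] (hfin : FiniteOnBounded m) (hdoub : LocUnifDoubling m)
    (hm : m ≠ 0) {Ω : Set X} (hΩ : IsOpen Ω) {f g : X → ℝ} (hf : Measurable f) (hg : Measurable g)
    {M : ℝ} (hM : ∀ x, |f x| ≤ M) (hM' : ∀ x, |g x| ≤ M)
    {e e' : X → ℝ} (he : IsEnergyDensity m Ω f e) (he' : IsEnergyDensity m Ω g e')
    {r : ℕ → ℝ} (hr : ∀ n, 0 < r n) (hr1 : ∀ n, r n < 1/2) (hr0 : Tendsto r atTop (𝓝 0)) (x0 : X) :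
    ∀ᵐ x ∂m.restrict Ω, ∀ δ : ℝ≥0∞, 0 < δ → ∃ᶠ n in atTop, TT m f (r n) x + TT m g (r n) x < δ := by
  have key : ∀ k : ℕ, ∀ᵐ x ∂m, x ∈ Ω → x ∈ ball x0 (k:ℝ) →
      ∀ δ : ℝ≥0∞, 0 < δ → ∃ᶠ n in atTop, TT m f (r n) x + TT m g (r n) x < δ := by
    intro k
    let F : ℕ → X → ℝ≥0∞ := fun n => Set.indicator (ZZ Ω x0 k (r n)) (fun x => TT m f (r n) x + TT m g (r n) x)
    have hFm : ∀ n, Measurable (F n) := fun n =>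
      ((meas_TT m hf (r n)).add (meas_TT m hg (r n))).indicator (meas_ZZ _ _ _ _)
    have hF : Tendsto (fun n => ∫⁻ x, F n x ∂m) atTop (𝓝 0) := by
      have := (step3 hfin hdoub hm hΩ hf hM he hr hr1 hr0 x0 k).add
        (step3 hfin hdoub hm hΩ hg hM' he' hr hr1 hr0 x0 k)
      rw [add_zero] at this
      refine this.congr fun n => ?_
      rw [← lintegral_add_left (meas_TT m hf (r n)), ← lintegral_indicator (meas_ZZ _ _ _ _)]
    have hfat := lintegral_liminf_le (μ := m) hFm (u := atTop)
    rw [hF.liminf_eq] at hfat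
    have h0 := (lintegral_eq_zero_iff (Measurable.liminf hFm)).1 (le_antisymm hfat zero_le)
    filter_upwards [h0] with x hx hxΩ hxk δ hδ
    have hx' : liminf (fun n => F n x) atTop < δ := by
      simp only [Pi.zero_apply] at hx
      rw [hx]; exact hδ
    have hfr := frequently_lt_of_liminf_lt (by isBoundedDefault) hx'
    obtain ⟨ε, hε, hεb⟩ := Metric.isOpen_iff.1 hΩ x hxΩ
    have hev : ∀ᶠ n in atTop, r n < ε / 4 := hr0.eventually_lt_const (by linarith)
    refine (hfr.and_eventually hev).mono ?_
    rintro n ⟨h1, h2⟩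
    have hmem : x ∈ ZZ Ω x0 k (r n) := ⟨hxk, (ball_subset_ball (by linarith)).trans hεb⟩
    simpa only [F, indicator_of_mem hmem] using h1
  rw [ae_restrict_iff' hΩ.measurableSet]
  filter_upwards [ae_all_iff.2 key] with x hx hxΩ
  obtain ⟨k, hk⟩ := exists_nat_gt (dist x x0)
  exact hx k hxΩ hk

lemma tt_real {m : Measure X} (hfin : FiniteOnBounded m) (hdoub : LocUnifDoubling m)
    (hm : m ≠ 0) {f : X → ℝ} (hf : Measurable f)
    {M : ℝ} (hM : ∀ x, |f x| ≤ M) {r : ℝ} (hr : 0 < r) (x : X) :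
    TT m f r x ≠ ⊤ ∧
    (TT m f r x).toReal * r ^ 2 * m.real (ball x r) = ∫ y in ball x r, |f x - f y| ^ 3 ∂m := by
  have hi := (integrableOn_sq hfin hf hM x x r 3).div_const (r ^ 2)
  have h1 : 0 < m.real (ball x r) :=
      ENNReal.toReal_pos (meas_ball_pos hdoub hm x hr).ne' (hfin _ isBounded_ball).ne
  have h2 : m (ball x r) = ENNReal.ofReal (m.real (ball x r)) :=
    (ENNReal.ofReal_toReal (hfin _ isBounded_ball).ne).symm
  have h0 : 0 ≤ ∫ y in ball x r, |f x - f y| ^ 3 ∂m := integral_nonneg fun y => by positivity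
  unfold TT
  rw [← ofReal_integral_eq_lintegral_ofReal hi
    (Eventually.of_forall fun y => by positivity), integral_div]
  rw [h2, ← ENNReal.ofReal_inv_of_pos h1, ← ENNReal.ofReal_mul (by positivity)]
  refine ⟨ENNReal.ofReal_ne_top, ?_⟩
  rw [ENNReal.toReal_ofReal (by positivity)]
  field_simp

lemma FA_bd (z : ℝ × ℝ) : |FA z| ≤ Real.pi / 2 :=
  abs_le.2 ⟨Real.neg_pi_div_two_le_arcsin _, Real.arcsin_le_pi_div_two _⟩

lemma FB_bd {ρ : ℝ} (hρ : ρ ∈ Set.Ioo 0 (Real.pi / 2)) (z : ℝ × ℝ) (h1 : z.1 ∈ Icc 0 ρ)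
    (h2 : z.2 ∈ Icc 0 (2 * ρ)) : |FB z| ≤ 1 / Real.cos ρ / Real.cos ρ := by
  have hc : 0 < Real.cos ρ := Real.cos_pos_of_mem_Ioo ⟨by linarith [hρ.1, Real.pi_pos], hρ.2⟩
  have hc1 : Real.cos ρ ≤ Real.cos z.1 :=
    Real.cos_le_cos_of_nonneg_of_le_pi h1.1 (by linarith [hρ.2, Real.pi_pos]) h1.2
  have hc2 : Real.cos ρ ≤ Real.cos (z.2 / 2) :=
    Real.cos_le_cos_of_nonneg_of_le_pi (by linarith [h2.1]) (by linarith [hρ.2, Real.pi_pos])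
      (by linarith [h2.2])
  unfold FB
  rw [Real.tan_eq_sin_div_cos, abs_div, abs_div, abs_of_pos (hc.trans_le hc1),
    abs_of_pos (hc.trans_le hc2)]
  have := Real.abs_sin_le_one (z.2 / 2)
  gcongr

lemma core_pt {m : Measure X} (hfin : FiniteOnBounded m) (hdoub : LocUnifDoubling m)
    (hm : m ≠ 0) {Ω : Set X} {ρ : ℝ} (hρ : ρ ∈ Set.Ioo 0 (Real.pi / 2))
    {f g : X → ℝ} (hf : Measurable f) (hg : Measurable g)
    (hf' : ∀ x, f x ∈ Icc 0 ρ) (hg' : ∀ x, g x ∈ Icc 0 (2 * ρ))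
    {x : X} {ε K : ℝ} (hK : ∀ w : ℝ × ℝ, w.1 ∈ Icc 0 ρ → w.2 ∈ Icc 0 (2 * ρ) →
      |HH (f x, g x) w| ≤ ε * ((f x - w.1) ^ 2 + (g x - w.2) ^ 2)
        + K * (|f x - w.1| ^ 3 + |g x - w.2| ^ 3))
    {r : ℝ} (hr : 0 < r) (hb : ball x r ⊆ Ω) :
    |ks2r m Ω (fun x => FA (f x, g x)) r x ^ 2
        + QQ (f x, g x) * ks2r m Ω (fun x => FB (f x, g x)) r x ^ 2
        - (Real.cos (g x / 2) ^ 2 * ks2r m Ω f r x ^ 2 + (1/4) * ks2r m Ω g r x ^ 2)|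
      ≤ ε * (ks2r m Ω f r x ^ 2 + ks2r m Ω g r x ^ 2) + K * (TT m f r x + TT m g r x).toReal := by
  have hMf : ∀ x, |f x| ≤ ρ := fun x => by rw [abs_of_nonneg (hf' x).1]; exact (hf' x).2
  have hMg : ∀ x, |g x| ≤ 2 * ρ := fun x => by rw [abs_of_nonneg (hg' x).1]; exact (hg' x).2
  have hAm : Measurable (fun x => FA (f x, g x)) := by unfold FA; fun_prop
  have hBm : Measurable (fun x => FB (f x, g x)) := by
    unfold FB; simp only [Real.tan_eq_sin_div_cos]; fun_prop
  have hAb : ∀ x, |FA (f x, g x)| ≤ Real.pi / 2 := fun x => FA_bd _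
  have hBb : ∀ x, |FB (f x, g x)| ≤ 1 / Real.cos ρ / Real.cos ρ :=
    fun x => FB_bd hρ _ (hf' x) (hg' x)
  have h1 : 0 < m.real (ball x r) :=
      ENNReal.toReal_pos (meas_ball_pos hdoub hm x hr).ne' (hfin _ isBounded_ball).ne
  have kA := ks_sq_real (f := fun x => FA (f x, g x)) hfin hdoub hm hr hb
  have kB := ks_sq_real (f := fun x => FB (f x, g x)) hfin hdoub hm hr hb
  have kf := ks_sq_real (f := f) hfin hdoub hm hr hb
  have kg := ks_sq_real (f := g) hfin hdoub hm hr hb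
  obtain ⟨tf0, tf⟩ := tt_real hfin hdoub hm hf hMf hr x
  obtain ⟨tg0, tg⟩ := tt_real hfin hdoub hm hg hMg hr x
  have iA := integrableOn_sq hfin hAm hAb x x r 2
  have iB := integrableOn_sq hfin hBm hBb x x r 2
  have if2 := integrableOn_sq hfin hf hMf x x r 2
  have ig2 := integrableOn_sq hfin hg hMg x x r 2
  have if3 := integrableOn_sq hfin hf hMf x x r 3
  have ig3 := integrableOn_sq hfin hg hMg x x r 3
  rw [ENNReal.toReal_add tf0 tg0]
  have j1 : IntegrableOn (fun y => ε * (|f x - f y| ^ 2 + |g x - g y| ^ 2)) (ball x r) m :=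
    (if2.add ig2).const_mul ε
  have j2 : IntegrableOn (fun y => K * (|f x - f y| ^ 3 + |g x - g y| ^ 3)) (ball x r) m :=
    (if3.add ig3).const_mul K
  have j3 : IntegrableOn (fun y => |FA (f x, g x) - FA (f y, g y)| ^ 2
      + QQ (f x, g x) * |FB (f x, g x) - FB (f y, g y)| ^ 2) (ball x r) m :=
    iA.add (iB.const_mul _)
  have j4 : IntegrableOn (fun y => Real.cos (g x / 2) ^ 2 * |f x - f y| ^ 2
      + (1/4) * |g x - g y| ^ 2) (ball x r) m :=
    (if2.const_mul _).add (ig2.const_mul _)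
  have e1 : ∫ y in ball x r, (ε * (|f x - f y| ^ 2 + |g x - g y| ^ 2)
      + K * (|f x - f y| ^ 3 + |g x - g y| ^ 3)) ∂m =
      ε * ((∫ y in ball x r, |f x - f y| ^ 2 ∂m) + ∫ y in ball x r, |g x - g y| ^ 2 ∂m)
      + K * ((∫ y in ball x r, |f x - f y| ^ 3 ∂m) + ∫ y in ball x r, |g x - g y| ^ 3 ∂m) := by
    rw [integral_add j1 j2, integral_const_mul,
      integral_const_mul, integral_add if2 ig2, integral_add if3 ig3]
  have e2 : ∫ y in ball x r, ((|FA (f x, g x) - FA (f y, g y)| ^ 2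
      + QQ (f x, g x) * |FB (f x, g x) - FB (f y, g y)| ^ 2)
      - (Real.cos (g x / 2) ^ 2 * |f x - f y| ^ 2 + (1/4) * |g x - g y| ^ 2)) ∂m =
      ((∫ y in ball x r, |FA (f x, g x) - FA (f y, g y)| ^ 2 ∂m)
      + QQ (f x, g x) * ∫ y in ball x r, |FB (f x, g x) - FB (f y, g y)| ^ 2 ∂m)
      - (Real.cos (g x / 2) ^ 2 * (∫ y in ball x r, |f x - f y| ^ 2 ∂m)
        + (1/4) * ∫ y in ball x r, |g x - g y| ^ 2 ∂m) := by
    rw [integral_sub j3 j4,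
      integral_add iA (iB.const_mul _), integral_add (if2.const_mul _) (ig2.const_mul _),
      integral_const_mul, integral_const_mul, integral_const_mul]
  have e3 := norm_integral_le_of_norm_le (μ := m.restrict (ball x r))
    (f := fun y => ((|FA (f x, g x) - FA (f y, g y)| ^ 2
      + QQ (f x, g x) * |FB (f x, g x) - FB (f y, g y)| ^ 2)
      - (Real.cos (g x / 2) ^ 2 * |f x - f y| ^ 2 + (1/4) * |g x - g y| ^ 2)))
    (g := fun y => (ε * (|f x - f y| ^ 2 + |g x - g y| ^ 2)
      + K * (|f x - f y| ^ 3 + |g x - g y| ^ 3)))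
    (by exact Integrable.add j1 j2)
    (Eventually.of_forall fun y => by
      have := hK (f y, g y) (hf' y) (hg' y)
      unfold HH at this
      simpa only [sq_abs, Real.norm_eq_abs] using this)
  rw [e1, e2, ← kA, ← kB, ← kf, ← kg, ← tf, ← tg, Real.norm_eq_abs] at e3
  set V := m.real (ball x r)
  have hpos : 0 < r ^ 2 * V := by positivity
  refine le_of_mul_le_mul_right ?_ hpos
  rw [← abs_of_pos hpos, ← abs_mul, abs_of_pos hpos]
  refine (le_of_eq ?_).trans (e3.trans (le_of_eq ?_))
  · congr 1; ring
  · ring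

lemma core {m : Measure X} (hfin : FiniteOnBounded m) (hdoub : LocUnifDoubling m)
    {Ω : Set X} (hΩ : IsOpen Ω) {ρ : ℝ} (hρ : ρ ∈ Set.Ioo 0 (Real.pi / 2))
    {f g : X → ℝ} (hf : Measurable f) (hg : Measurable g)
    (hf' : ∀ x, f x ∈ Icc 0 ρ) (hg' : ∀ x, g x ∈ Icc 0 (2 * ρ))
    {e₁ e₂ ef eg : X → ℝ}
    (he₁ : IsEnergyDensity m Ω (fun x => FA (f x, g x)) e₁)
    (he₂ : IsEnergyDensity m Ω (fun x => FB (f x, g x)) e₂)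
    (hef : IsEnergyDensity m Ω f ef) (heg : IsEnergyDensity m Ω g eg) :
    ∀ᵐ x ∂m.restrict Ω, e₁ x ^ 2 + QQ (f x, g x) * e₂ x ^ 2
      = Real.cos (g x / 2) ^ 2 * ef x ^ 2 + (1/4) * eg x ^ 2 := by
  by_cases hm : m = 0
  · subst hm; simp
  by_cases hX : IsEmpty X
  · exact Eventually.of_forall fun x => hX.elim x
  rw [not_isEmpty_iff] at hX
  obtain ⟨x0⟩ := hX
  have : SecondCountableTopology X := UniformSpace.secondCountable_of_separable X
  have : IsLocallyFiniteMeasure m :=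
    ⟨fun x => ⟨ball x 1, ball_mem_nhds x one_pos, hfin _ isBounded_ball⟩⟩
  have : SigmaFinite m := inferInstance
  have hMf : ∀ x, |f x| ≤ ρ := fun x => by rw [abs_of_nonneg (hf' x).1]; exact (hf' x).2
  have hMg : ∀ x, |g x| ≤ 2 * ρ := fun x => by rw [abs_of_nonneg (hg' x).1]; exact (hg' x).2
  have hMf2 : ∀ x, |f x| ≤ 2 * ρ := fun x => (hMf x).trans (by linarith [hρ.1])
  set r : ℕ → ℝ := fun n => 1 / ((n : ℝ) + 3) with hrdef
  have hr : ∀ n, 0 < r n := fun n => by simp only [hrdef]; positivity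
  have hr1 : ∀ n, r n < 1 / 2 := fun n => by
    simp only [hrdef]
    rw [div_lt_div_iff₀ (by positivity) (by norm_num)]
    have : (0:ℝ) ≤ n := Nat.cast_nonneg n
    linarith
  have hr0 : Tendsto r atTop (𝓝 0) :=
    (tendsto_const_nhds (x := (1:ℝ))).div_atTop
      (tendsto_atTop_add_const_right _ _ tendsto_natCast_atTop_atTop)
  have hr' : Tendsto r atTop (𝓝[>] 0) :=
    tendsto_nhdsWithin_iff.2 ⟨hr0, Eventually.of_forall hr⟩
  filter_upwards [he₁.1, he₂.1, hef.1, heg.1, ae_restrict_mem hΩ.measurableSet,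
    step4 hfin hdoub hm hΩ hf hg hMf2 hMg hef heg hr hr1 hr0 x0] with x t1 t2 tf tg hx h4
  have t1 := t1.comp hr'
  have t2 := t2.comp hr'
  have tf := tf.comp hr'
  have tg := tg.comp hr'
  have hball : ∀ᶠ n in atTop, ball x (r n) ⊆ Ω := by
    obtain ⟨δ, hδ, hs⟩ := Metric.isOpen_iff.1 hΩ x hx
    filter_upwards [hr0.eventually_lt_const hδ] with n hn
    exact (ball_subset_ball hn.le).trans hs
  set L := e₁ x ^ 2 + QQ (f x, g x) * e₂ x ^ 2
      - (Real.cos (g x / 2) ^ 2 * ef x ^ 2 + (1/4) * eg x ^ 2) with hL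
  have tL := ((t1.pow 2).add ((t2.pow 2).const_mul (QQ (f x, g x)))).sub
    (((tf.pow 2).const_mul (Real.cos (g x / 2) ^ 2)).add ((tg.pow 2).const_mul (1/4)))
  rw [← hL] at tL
  have tS := (tf.pow 2).add (tg.pow 2)
  have hbd : ∀ ε : ℝ, 0 < ε → |L| ≤ ε * (ef x ^ 2 + eg x ^ 2 + 1) := by
    intro ε hε
    obtain ⟨K, hK0, hK⟩ := HH_bound hρ (f x, g x) (hf' x) (hg' x) hε
    have hlim : Tendsto (fun n => |ks2r m Ω (fun x => FA (f x, g x)) (r n) x ^ 2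
        + QQ (f x, g x) * ks2r m Ω (fun x => FB (f x, g x)) (r n) x ^ 2
        - (Real.cos (g x / 2) ^ 2 * ks2r m Ω f (r n) x ^ 2 + (1/4) * ks2r m Ω g (r n) x ^ 2)|
        - ε * (ks2r m Ω f (r n) x ^ 2 + ks2r m Ω g (r n) x ^ 2)) atTop
        (𝓝 (|L| - ε * (ef x ^ 2 + eg x ^ 2))) := tL.abs.sub (tS.const_mul ε)
    have hδ : (0:ℝ) < ε / (K + 1) := by positivity
    have hfr := (h4 (ENNReal.ofReal (ε / (K + 1))) (ENNReal.ofReal_pos.2 hδ)).and_eventually hball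
    have : |L| - ε * (ef x ^ 2 + eg x ^ 2) ≤ ε := by
      refine le_of_tendsto_of_frequently hlim (hfr.mono fun n hn => ?_)
      have h := core_pt hfin hdoub hm hρ hf hg hf' hg' (x := x) hK (hr n) hn.2
      have h7 : (TT m f (r n) x + TT m g (r n) x).toReal ≤ ε / (K + 1) :=
        ENNReal.toReal_le_of_le_ofReal hδ.le hn.1.le
      have h8 : K * (TT m f (r n) x + TT m g (r n) x).toReal ≤ ε := by
        calc _ ≤ (K + 1) * (ε / (K + 1)) := by
              apply mul_le_mul (by linarith) h7 ENNReal.toReal_nonneg (by positivity)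
          _ = ε := by field_simp
      linarith
    linarith
  have hS1 : 0 < ef x ^ 2 + eg x ^ 2 + 1 := by positivity
  have hL0 : |L| ≤ 0 := by
    refine le_of_forall_pos_le_add fun ε hε => ?_
    have := hbd (ε / (ef x ^ 2 + eg x ^ 2 + 1)) (by positivity)
    rw [div_mul_cancel₀ _ hS1.ne'] at this
    linarith
  have := abs_nonpos_iff.1 hL0
  linarith

end main

lemma cat_mid_unique {Y : Type*} [MetricSpace Y] (hY : IsCAT 1 Y) {a b p q : Y}
    (hp : IsGeodMidpoint a b p) (hq : IsGeodMidpoint a b q) (hab : dist a b < Real.pi) :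
    p = q := by
  have hd : dist p a = dist a b / 2 ∧ dist p b = dist a b / 2 := by
    obtain ⟨γ, hγ, h0, h1, h2⟩ := hp
    have a1 := hγ (1/2) ⟨by norm_num, by norm_num⟩ 0 ⟨by norm_num, by norm_num⟩
    have a2 := hγ (1/2) ⟨by norm_num, by norm_num⟩ 1 ⟨by norm_num, by norm_num⟩
    rw [h0, h1, h2] at a1 a2
    norm_num at a1 a2
    constructor <;> linarith
  have hcos : 0 < Real.cos (dist a b / 2) :=
    Real.cos_pos_of_mem_Ioo ⟨by linarith [Real.pi_pos, dist_nonneg (x := a) (y := b)],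
      by linarith⟩
  have h := cat_mid hY p a b q hq hab (by rw [hd.1, hd.2]; linarith)
  rw [hd.1, hd.2, ← two_mul, div_self (by positivity), Real.arccos_one] at h
  exact dist_le_zero.1 h

lemma meas_final {X Y : Type*} [MetricSpace X] [MeasurableSpace X] [BorelSpace X] [MetricSpace Y]
    {m : Measure X} {Ω : Set X} (hΩ : IsOpen Ω)
    (hY : IsCAT 1 Y) (o : Y) {ρ : ℝ} (hρ : ρ ∈ Set.Ioo 0 (Real.pi / 2))
    {u v : X → Y}
    (hu_ball : ∀ x ∈ Ω, u x ∈ Metric.closedBall o ρ)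
    (hv_ball : ∀ x ∈ Ω, v x ∈ Metric.closedBall o ρ)
    (hu : MemL2 m Ω o u) (hv : MemL2 m Ω o v)
    {mhat : X → Y} (hmid : ∀ x ∈ Ω, IsGeodMidpoint (u x) (v x) (mhat x)) :
    Measurable (Ω.indicator fun x => dist (mhat x) o) ∧
    Measurable (Ω.indicator fun x => dist (u x) (v x)) := by
  letI : MeasurableSpace Y := borel Y
  haveI : BorelSpace Y := ⟨rfl⟩
  have hum : Measurable u := measurable_of_isOpen hu.1
  have hvm : Measurable v := measurable_of_isOpen hv.1
  set S : Set Y := u '' Ω ∪ v '' Ω with hS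
  have hSb : S ⊆ closedBall o ρ := by
    rintro y (⟨x, hx, rfl⟩ | ⟨x, hx, rfl⟩)
    · exact hu_ball x hx
    · exact hv_ball x hx
  have hsep : TopologicalSpace.IsSeparable S := hu.2.1.union hv.2.1
  have : TopologicalSpace.SeparableSpace S := hsep.separableSpace
  have : SecondCountableTopology S := UniformSpace.secondCountable_of_separable S
  have hex : ∀ z : S × S, ∃ q : Y, IsGeodMidpoint (z.1 : Y) (z.2 : Y) q := by
    intro z
    obtain ⟨γ, h, h0, h1⟩ := hY.1 z.1 z.2
    exact ⟨γ (1/2), γ, h, h0, h1, rfl⟩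
  choose q hq using hex
  have hqc := cat_mid_cont hY o hρ S hSb q hq
  let φ : Ω → S × S := fun x => (⟨u x, Or.inl ⟨x, x.2, rfl⟩⟩, ⟨v x, Or.inr ⟨x, x.2, rfl⟩⟩)
  have hφ : Measurable φ := by
    refine Measurable.prodMk ?_ ?_
    · exact (hum.comp measurable_subtype_coe).subtype_mk
    · exact (hvm.comp measurable_subtype_coe).subtype_mk
  have hext : ∀ f : X → ℝ, Measurable (fun x : Ω => f x) → Measurable (Ω.indicator f) := by
    intro f hf
    apply measurable_of_restrict_of_restrict_compl hΩ.measurableSet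
    · convert hf using 1
      ext x
      simp
    · have : Ωᶜ.domRestrict (Ω.indicator f) = fun _ => 0 := by
        ext x
        exact indicator_of_notMem x.2 f
      rw [this]; exact measurable_const
  constructor
  · apply hext
    have h1 : (fun x : Ω => dist (mhat x) o) = (fun z => dist (q z) o) ∘ φ := by
      ext x
      have : mhat x = q (φ x) := by
        refine cat_mid_unique hY (hmid x x.2) (hq (φ x)) ?_
        have h1 := hu_ball x x.2
        have h2 := hv_ball x x.2
        rw [mem_closedBall'] at h1 h2
        linarith [dist_triangle_left (u x) (v x) o, hρ.2]
      simp [this]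
    rw [h1]
    exact (by fun_prop : Continuous (fun z => dist (q z) o)).measurable.comp hφ
  · apply hext
    have h1 : (fun x : Ω => dist (u x) (v x)) = (fun z : S × S => dist (z.1 : Y) (z.2 : Y)) ∘ φ := rfl
    rw [h1]
    exact (by fun_prop : Continuous (fun z : S × S => dist (z.1 : Y) (z.2 : Y))).measurable.comp hφ

/-- Identity of energy densities used in the convexity of the energy:
with `D = d_Y(u,v)`, `𝔡 = d_Y(m̂,o)` and `η` determined by
`sin((1−η)𝔡) = cos(D/2)·sin(𝔡)`, one has a.e. on `Ω`
`e₂[(1−η)𝔡]² + (cos⁴(D/2)cos⁴𝔡 /(1−cos²(D/2)sin²𝔡))·e₂[tan(D/2)/cos𝔡]²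
  = cos²(D/2)·e₂[𝔡]² + (1/4)·e₂[D]²`. -/
theorem energy_density_identity
    {X Y : Type*} [MetricSpace X] [CompleteSpace X] [TopologicalSpace.SeparableSpace X]
    [MeasurableSpace X] [BorelSpace X] [MetricSpace Y] [CompleteSpace Y]
    (m : Measure X) (hfin : FiniteOnBounded m)
    (d : ℕ) (hdoub : LocUnifDoubling m) (hrect : StronglyRectifiable m d)
    (hPI : PoincareIneq m) (hHil : InfHilbertian m)
    (Ω : Set X) (hΩopen : IsOpen Ω)
    (hY : IsCAT 1 Y) (o : Y) (ρ : ℝ) (hρ : ρ ∈ Set.Ioo 0 (Real.pi / 2))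
    (u v : X → Y)
    (hu_ball : ∀ x ∈ Ω, u x ∈ Metric.closedBall o ρ)
    (hv_ball : ∀ x ∈ Ω, v x ∈ Metric.closedBall o ρ)
    (hu : MemKS m Ω o u) (hv : MemKS m Ω o v)
    (mhat : X → Y) (hmid : ∀ x ∈ Ω, IsGeodMidpoint (u x) (v x) (mhat x))
    (η : X → ℝ) (hη_range : ∀ x ∈ Ω, η x ∈ Set.Icc (0:ℝ) 1)
    (hη : MemKS m Ω (0:ℝ) η)
    (hη_def : ∀ x ∈ Ω,
      Real.sin ((1 - η x) * dist (mhat x) o) =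
        Real.cos (dist (u x) (v x) / 2) * Real.sin (dist (mhat x) o))
    (e₁ e₂' eδ eD : X → ℝ)
    (he₁ : IsEnergyDensity m Ω (fun x => (1 - η x) * dist (mhat x) o) e₁)
    (he₂ : IsEnergyDensity m Ω
      (fun x => Real.tan (dist (u x) (v x) / 2) / Real.cos (dist (mhat x) o)) e₂')
    (heδ : IsEnergyDensity m Ω (fun x => dist (mhat x) o) eδ)
    (heD : IsEnergyDensity m Ω (fun x => dist (u x) (v x)) eD) :
    ∀ᵐ x ∂m.restrict Ω,
      e₁ x ^ 2 +
          Real.cos (dist (u x) (v x) / 2) ^ 4 * Real.cos (dist (mhat x) o) ^ 4 /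
              (1 - Real.cos (dist (u x) (v x) / 2) ^ 2 * Real.sin (dist (mhat x) o) ^ 2) *
            e₂' x ^ 2 =
        Real.cos (dist (u x) (v x) / 2) ^ 2 * eδ x ^ 2 + (1/4) * eD x ^ 2 := by
  obtain ⟨hdm, hDm⟩ := meas_final hΩopen hY o hρ hu_ball hv_ball hu.1 hv.1 hmid
  have hd : ∀ x ∈ Ω, dist (mhat x) o ∈ Icc 0 ρ := fun x hx =>
    ⟨dist_nonneg, cat_mid_ball hY hρ (hu_ball x hx) (hv_ball x hx) (hmid x hx)⟩
  have hD : ∀ x ∈ Ω, dist (u x) (v x) ∈ Icc 0 (2 * ρ) := fun x hx => by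
    have h1 := hu_ball x hx
    have h2 := hv_ball x hx
    rw [mem_closedBall'] at h1 h2
    exact ⟨dist_nonneg, by linarith [dist_triangle_left (u x) (v x) o]⟩
  set f := Ω.indicator fun x => dist (mhat x) o with hfdef
  set g := Ω.indicator fun x => dist (u x) (v x) with hgdef
  have hfe : ∀ x ∈ Ω, f x = dist (mhat x) o := fun x hx => indicator_of_mem hx _
  have hge : ∀ x ∈ Ω, g x = dist (u x) (v x) := fun x hx => indicator_of_mem hx _
  have hf' : ∀ x, f x ∈ Icc 0 ρ := by
    intro x
    by_cases hx : x ∈ Ω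
    · rw [hfe x hx]; exact hd x hx
    · rw [hfdef, indicator_of_notMem hx]; exact ⟨le_rfl, hρ.1.le⟩
  have hg' : ∀ x, g x ∈ Icc 0 (2 * ρ) := by
    intro x
    by_cases hx : x ∈ Ω
    · rw [hge x hx]; exact hD x hx
    · rw [hgdef, indicator_of_notMem hx]; exact ⟨le_rfl, by linarith [hρ.1]⟩
  have h1 : IsEnergyDensity m Ω (fun x => FA (f x, g x)) e₁ := by
    refine he₁.congr' fun x hx => ?_
    unfold FA
    simp only [hfe x hx, hge x hx]
    rw [← hη_def x hx]
    have ha := hd x hx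
    have hb := hη_range x hx
    have hc : 0 ≤ (1 - η x) * dist (mhat x) o := mul_nonneg (by linarith [hb.2]) ha.1
    have hc' : (1 - η x) * dist (mhat x) o ≤ dist (mhat x) o :=
      mul_le_of_le_one_left ha.1 (by linarith [hb.1])
    rw [Real.arcsin_sin (by linarith [Real.pi_pos]) (by linarith [ha.2, hρ.2])]
  have h2 : IsEnergyDensity m Ω (fun x => FB (f x, g x)) e₂' := by
    refine he₂.congr' fun x hx => ?_
    unfold FB
    simp only [hfe x hx, hge x hx]
  have h3 : IsEnergyDensity m Ω f eδ := heδ.congr' fun x hx => (hfe x hx).symm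
  have h4 : IsEnergyDensity m Ω g eD := heD.congr' fun x hx => (hge x hx).symm
  filter_upwards [core hfin hdoub hΩopen hρ hdm hDm hf' hg' h1 h2 h3 h4,
    ae_restrict_mem hΩopen.measurableSet] with x hx hxΩ
  unfold QQ at hx
  simp only [hfe x hxΩ, hge x hxΩ] at hx
  exact hx

end KSH
end
end

section
/- Let (Y,d_Y) be a CAT(1) space and let γ, η : [0,1] → Y be geodesics with d_Y(γ_0,η_0) + d_Y(η_0,η_1) + d_Y(η_1,γ_1) + d_Y(γ_1,γ_0) < 2π. Then cos²(d_Y(γ_0,γ_1)/2)·d_Y(γ_{1/2},η_{1/2})² + (1/4)·(d_Y(η_0,η_1) − d_Y(γ_0,γ_1))² ≤ (1/2)·(d_Y(γ_0,η_0)² + d_Y(γ_1,η_1)²) + Cub(d_Y(γ_0,η_0), d_Y(γ_1,η_1), d_Y(η_0,η_1) − d_Y(γ_0,γ_1), d_Y(γ_{1/2},η_{1/2})), where Cub denotes an error term bounded in absolute value by a universal constant times a finite sum of monomials of total degree 3 in the absolute values of the indicated quantities, in each of which at least one variable occurs with exponent at least 2. -/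
open MeasureTheory Metric Filter Topology Set
open scoped ENNReal NNReal

noncomputable section

namespace KSH

attribute [local instance] Classical.propDecidable

variable {X Y : Type*}

theorem cat_vec {Z : Type*} [MetricSpace Z] (hZ : IsCAT 1 Z) (p : Z) (σ : ℝ → Z)
    (hσ : IsGeodesic σ)
    (hper : dist p (σ 0) + dist p (σ 1) + dist (σ 0) (σ 1) < 2 * Real.pi)
    (t : ℝ) (ht : t ∈ Set.Icc (0:ℝ) 1) :
    Real.sin ((1 - t) * dist (σ 0) (σ 1)) * Real.cos (dist p (σ 0)) +
      Real.sin (t * dist (σ 0) (σ 1)) * Real.cos (dist p (σ 1)) ≤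
    Real.sin (dist (σ 0) (σ 1)) * Real.cos (dist p (σ t)) := by
  have h2 := hZ.2 p σ hσ
  have hA0 : 0 ≤ dist p (σ 0) := dist_nonneg
  have hB0 : 0 ≤ dist p (σ 1) := dist_nonneg
  have hc0 : 0 ≤ dist (σ 0) (σ 1) := dist_nonneg
  have t1 : dist (σ 0) (σ 1) ≤ dist p (σ 0) + dist p (σ 1) := dist_triangle_left _ _ _
  have t2 : dist p (σ 1) ≤ dist p (σ 0) + dist (σ 0) (σ 1) := dist_triangle _ _ _
  have t3 : dist p (σ 0) ≤ dist p (σ 1) + dist (σ 0) (σ 1) := dist_triangle_right _ _ _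
  have hd : dist (σ 0) (σ t) = t * dist (σ 0) (σ 1) := by
    have := hσ 0 (by simp) t ht
    rw [this, zero_sub, abs_neg, abs_of_nonneg ht.1]
  rcases hA0.eq_or_lt with hA | hA
  · have hp : p = σ 0 := dist_eq_zero.1 hA.symm
    subst hp
    rw [hd, dist_self, Real.cos_zero, sub_mul, one_mul, Real.sin_sub]
    apply le_of_eq; ring
  rcases hc0.eq_or_lt with hc | hc
  · rw [← hc]; simp
  have h3 := h2 hA hc (by
    simp only [modelDiam, zero_lt_one, if_true, Real.sqrt_one, div_one]
    rw [show (2:ℝ≥0∞) = ENNReal.ofReal 2 by simp, ← ENNReal.ofReal_mul (by norm_num)]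
    exact (ENNReal.ofReal_lt_ofReal_iff (by positivity)).2 hper) t ht
  simp only [modelDist, modelCosAngle, zero_lt_one, if_true, Real.sqrt_one, div_one, one_mul] at h3
  have hd0 : 0 ≤ dist p (σ t) := dist_nonneg
  generalize dist p (σ t) = D at *
  generalize dist p (σ 0) = A at *
  generalize dist p (σ 1) = B at *
  generalize dist (σ 0) (σ 1) = c at *
  have hsA : 0 < Real.sin A := Real.sin_pos_of_pos_of_lt_pi hA (by linarith)
  have hsc : 0 < Real.sin c := Real.sin_pos_of_pos_of_lt_pi hc (by linarith)
  have htc : t * c ≤ c := by nlinarith [ht.2]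
  have htc0 : 0 ≤ t * c := mul_nonneg ht.1 hc0
  have hss : 0 ≤ Real.sin (t * c) := Real.sin_nonneg_of_nonneg_of_le_pi htc0 (by linarith)
  have hcosB : Real.cos B ≤ Real.cos (A - c) := by
    rw [← Real.cos_abs (A - c)]
    apply Real.cos_le_cos_of_nonneg_of_le_pi (abs_nonneg _) (by linarith)
    rw [abs_le]; constructor <;> linarith
  rw [Real.cos_sub] at hcosB
  have hang : (Real.cos B - Real.cos A * Real.cos c) / (Real.sin A * Real.sin c) ≤ 1 := by
    rw [div_le_one (by positivity)]; linarith
  set v := Real.cos A * Real.cos (t * c) + Real.sin A * Real.sin (t * c) *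
    ((Real.cos B - Real.cos A * Real.cos c) / (Real.sin A * Real.sin c)) with hv
  have hv1 : v ≤ 1 := by
    have : v ≤ Real.cos (A - t * c) := by
      rw [Real.cos_sub, hv]
      have := mul_le_mul_of_nonneg_left hang (mul_nonneg hsA.le hss)
      linarith
    exact this.trans (Real.cos_le_one _)
  have hvD : v ≤ Real.cos D := by
    rcases le_or_gt (-1) v with h | h
    · rw [← Real.cos_arccos h hv1]
      exact Real.cos_le_cos_of_nonneg_of_le_pi hd0 (Real.arccos_le_pi _) h3
    · linarith [Real.neg_one_le_cos D]
  have : Real.sin c * v = Real.sin ((1 - t) * c) * Real.cos A + Real.sin (t * c) * Real.cos B := by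
    rw [hv, sub_mul, one_mul, Real.sin_sub]
    field_simp
    ring
  rw [← this]
  exact mul_le_mul_of_nonneg_left hvD hsc.le

theorem cat_mid_s14 {Z : Type*} [MetricSpace Z] (hZ : IsCAT 1 Z) (p : Z) (σ : ℝ → Z)
    (hσ : IsGeodesic σ)
    (hper : dist p (σ 0) + dist p (σ 1) + dist (σ 0) (σ 1) < 2 * Real.pi) :
    Real.cos (dist p (σ 0)) + Real.cos (dist p (σ 1)) ≤
    2 * Real.cos (dist (σ 0) (σ 1) / 2) * Real.cos (dist p (σ (1/2))) := by
  have h := cat_vec hZ p σ hσ hper (1/2) (by norm_num)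
  have hc0 : 0 ≤ dist (σ 0) (σ 1) := dist_nonneg
  have t1 : dist (σ 0) (σ 1) ≤ dist p (σ 0) + dist p (σ 1) := dist_triangle_left _ _ _
  rcases hc0.eq_or_lt with hc | hc
  · have e1 : σ 0 = σ 1 := dist_eq_zero.1 hc.symm
    have e2 : σ 0 = σ (1/2) := by
      have := hσ 0 (by simp) (1/2) (by norm_num)
      rw [← hc, mul_zero] at this
      exact dist_eq_zero.1 this
    rw [← hc, ← e1, ← e2]
    simp; linarith
  · have hs : 0 < Real.sin (dist (σ 0) (σ 1) / 2) :=
      Real.sin_pos_of_pos_of_lt_pi (by linarith) (by linarith)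
    have h2 : Real.sin (dist (σ 0) (σ 1)) =
        2 * Real.sin (dist (σ 0) (σ 1) / 2) * Real.cos (dist (σ 0) (σ 1) / 2) := by
      rw [← Real.sin_two_mul]; ring_nf
    rw [h2, show (1 - 1/2 : ℝ) * dist (σ 0) (σ 1) = dist (σ 0) (σ 1) / 2 by ring,
      show (1/2 : ℝ) * dist (σ 0) (σ 1) = dist (σ 0) (σ 1) / 2 by ring] at h
    refine le_of_mul_le_mul_left ?_ hs
    linarith

/-- The point on a geodesic corresponding to a positive combination. -/
theorem cat_comb {Z : Type*} [MetricSpace Z] (hZ : IsCAT 1 Z) (P R : Z)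
    (he : dist P R < Real.pi) (μ l : ℝ) (hμ : 0 < μ) (hl : 0 < l) :
    ∃ (x : Z) (ν : ℝ), ν ^ 2 = μ ^ 2 + l ^ 2 + 2 * μ * l * Real.cos (dist P R) ∧ 0 ≤ ν ∧
      dist P x + dist x R = dist P R ∧
      ∀ y : Z, dist y P + dist y R + dist P R < 2 * Real.pi →
        μ * Real.cos (dist y P) + l * Real.cos (dist y R) ≤ ν * Real.cos (dist y x) := by
  have he0 : 0 ≤ dist P R := dist_nonneg
  rcases he0.eq_or_lt with h0 | h0
  · have : P = R := dist_eq_zero.1 h0.symm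
    subst this
    refine ⟨P, μ + l, by simp; ring, by positivity, by simp, fun y _ => by linarith⟩
  obtain ⟨σ, hσ, rfl, rfl⟩ := hZ.1 P R
  have hse : 0 < Real.sin (dist (σ 0) (σ 1)) := Real.sin_pos_of_pos_of_lt_pi h0 he
  have hdx : ∀ t ∈ Set.Icc (0:ℝ) 1,
      dist (σ 0) (σ t) + dist (σ t) (σ 1) = dist (σ 0) (σ 1) := by
    intro t ht
    rw [hσ 0 (by simp) t ht, hσ t ht 1 (by simp), zero_sub, abs_neg, abs_of_nonneg ht.1,
      abs_of_nonpos (by linarith [ht.2])]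
    ring
  have hvec := fun y => cat_vec hZ y σ hσ
  generalize dist (σ 0) (σ 1) = e at *
  have hcont : ContinuousOn (fun t : ℝ => μ * Real.sin (t * e) - l * Real.sin ((1 - t) * e))
      (Set.Icc 0 1) := by fun_prop
  obtain ⟨t, ht, hft⟩ := intermediate_value_Icc (zero_le_one' ℝ) hcont
    (show (0:ℝ) ∈ Set.Icc _ _ by
      constructor
      · simp; positivity
      · simp; positivity)
  simp only at hft
  have hα : 0 ≤ Real.sin (t * e) := Real.sin_nonneg_of_nonneg_of_le_pi
    (mul_nonneg ht.1 he0) (by nlinarith [ht.2])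
  have hsum : Real.sin e = Real.sin (t * e) * Real.cos ((1 - t) * e) +
      Real.cos (t * e) * Real.sin ((1 - t) * e) := by
    rw [← Real.sin_add]; ring_nf
  have hcsum : Real.cos e = Real.cos (t * e) * Real.cos ((1 - t) * e) -
      Real.sin (t * e) * Real.sin ((1 - t) * e) := by
    rw [← Real.cos_add]; ring_nf
  obtain ⟨κ, hκ⟩ : ∃ κ, κ = Real.sin (t * e) / l := ⟨_, rfl⟩
  have hA : Real.sin (t * e) = κ * l := by rw [hκ]; field_simp
  have hB : Real.sin ((1 - t) * e) = κ * μ := by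
    rw [hA] at hft
    have : l * (Real.sin ((1 - t) * e) - κ * μ) = 0 := by linarith
    rcases mul_eq_zero.1 this with h | h <;> linarith
  have hκ0 : 0 < κ := by
    have : 0 ≤ κ := by rw [hκ]; positivity
    rcases this.eq_or_lt with h | h
    · rw [hA, hB, ← h] at hsum; simp at hsum; linarith
    · exact h
  refine ⟨σ t, Real.sin e / κ, ?_, by positivity, hdx t ht, ?_⟩
  · rw [div_pow, div_eq_iff (by positivity)]
    have i1 := Real.sin_sq_add_cos_sq (t * e)
    have i2 := Real.sin_sq_add_cos_sq ((1 - t) * e)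
    have : Real.sin e ^ 2 = Real.sin (t * e) ^ 2 + Real.sin ((1 - t) * e) ^ 2 +
        2 * Real.sin (t * e) * Real.sin ((1 - t) * e) * Real.cos e := by
      rw [hsum, hcsum]
      generalize Real.sin (t * e) = a at *
      generalize Real.sin ((1 - t) * e) = b at *
      generalize Real.cos (t * e) = c at *
      generalize Real.cos ((1 - t) * e) = d at *
      linear_combination (a^2) * i2 + b^2 * i1
    rw [this, hA, hB]; ring
  · intro y hy
    have := hvec y hy t ht
    rw [hA, hB] at this
    rw [div_mul_eq_mul_div, le_div_iff₀ hκ0]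
    linarith

theorem circle_ineq (μ l ν p q d : ℝ) (hμ : 0 ≤ μ) (hl : 0 ≤ l) (hν : 0 ≤ ν) (hp : 0 ≤ p)
    (hq : 0 ≤ q) (hpp : p ≤ Real.pi) (hqp : q ≤ Real.pi)
    (hd0 : 0 ≤ d) (hd : d ≤ p + q) :
    2 * ν * (μ * Real.cos p + l * Real.cos q) ≤
      μ ^ 2 + l ^ 2 + ν ^ 2 + 2 * μ * l * Real.cos d := by
  obtain ⟨p', q', hp0, hq0, hp1, hq1, hs⟩ :
      ∃ p' q', 0 ≤ p' ∧ 0 ≤ q' ∧ p' ≤ p ∧ q' ≤ q ∧ d = p' + q' := by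
    rcases le_total p d with h | h
    · exact ⟨p, d - p, hp, by linarith, le_rfl, by linarith, by ring⟩
    · exact ⟨d, 0, hd0, le_rfl, h, hq, by ring⟩
  have c1 : Real.cos p ≤ Real.cos p' := Real.cos_le_cos_of_nonneg_of_le_pi hp0 hpp hp1
  have c2 : Real.cos q ≤ Real.cos q' := Real.cos_le_cos_of_nonneg_of_le_pi hq0 hqp hq1
  have : 2 * ν * (μ * Real.cos p + l * Real.cos q) ≤
      2 * ν * (μ * Real.cos p' + l * Real.cos q') := by gcongr
  refine this.trans ?_
  rw [hs, Real.cos_add]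
  have i1 := Real.sin_sq_add_cos_sq p'
  have i2 := Real.sin_sq_add_cos_sq q'
  nlinarith [sq_nonneg (μ * Real.cos p' + l * Real.cos q' - ν),
    sq_nonneg (μ * Real.sin p' - l * Real.sin q'), i1, i2]

theorem dist_lt_pi {Z : Type*} [MetricSpace Z] (x y z : Z)
    (h : dist z x + dist z y + dist x y < 2 * Real.pi) : dist x y < Real.pi := by
  linarith [dist_triangle_left x y z]

theorem cat_quad {Z : Type*} [MetricSpace Z] (hZ : IsCAT 1 Z) (P Q R S : Z)
    (h : dist P S + dist S R + dist R Q + dist Q P < 2 * Real.pi) :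
    Real.cos (dist P S) + Real.cos (dist Q R) -
      4 * Real.sin (dist P Q / 2) * Real.sin (dist S R / 2) ≤
    Real.cos (dist P R) + Real.cos (dist Q S) := by
  have a1 := dist_triangle P S R
  have a2 := dist_triangle P Q R
  have a3 := dist_triangle Q P S
  have a4 := dist_triangle Q R S
  have a5 := dist_triangle P Q S
  have a6 := dist_triangle Q P R
  have a7 := dist_triangle S P R
  rw [dist_comm Q P, dist_comm R Q] at h
  rw [dist_comm Q P] at a3 a6
  rw [dist_comm R S] at a4
  rw [dist_comm S P] at a7
  have hPQ : 0 ≤ dist P Q := dist_nonneg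
  have hSR : 0 ≤ dist S R := dist_nonneg
  have hPS : 0 ≤ dist P S := dist_nonneg
  have hQR : 0 ≤ dist Q R := dist_nonneg
  have b1 := dist_triangle P R S
  have b2 := dist_triangle_left P Q R
  have b3 := dist_triangle_left S R P
  have b4 := dist_triangle_right P Q S
  have b5 := dist_triangle_left S R Q
  rcases hPQ.eq_or_lt with hL | hL
  · have : P = Q := dist_eq_zero.1 hL.symm
    subst this; simp; linarith
  rcases hSR.eq_or_lt with hM | hM
  · have : S = R := dist_eq_zero.1 hM.symm
    subst this; simp
  have hLpi : dist P Q < Real.pi := by linarith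
  have hMpi : dist S R < Real.pi := by linarith
  have hs : 0 < Real.sin (dist P Q / 2) := Real.sin_pos_of_pos_of_lt_pi (by linarith) (by linarith)
  have hs' : 0 < Real.sin (dist S R / 2) := Real.sin_pos_of_pos_of_lt_pi (by linarith) (by linarith)
  obtain ⟨x, ν, hν2, hν, hbet, hx⟩ := cat_comb hZ P R (by linarith) _ _ hs' hs
  have hQ := hx Q (by rw [dist_comm Q P]; linarith)
  have hS := hx S (by rw [dist_comm S P]; linarith)
  have cL : Real.cos (dist P Q) = 1 - 2 * Real.sin (dist P Q / 2) ^ 2 := by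
    have := Real.cos_two_mul (dist P Q / 2)
    rw [Real.cos_sq'] at this
    rw [← show 2 * (dist P Q / 2) = dist P Q by ring, this]; ring_nf
  have cM : Real.cos (dist S R) = 1 - 2 * Real.sin (dist S R / 2) ^ 2 := by
    have := Real.cos_two_mul (dist S R / 2)
    rw [Real.cos_sq'] at this
    rw [← show 2 * (dist S R / 2) = dist S R by ring, this]; ring_nf
  have hPi : ∀ y : Z, dist y P + dist y R + dist P R < 2 * Real.pi → dist y x ≤ Real.pi := by
    intro y hy
    have n1 := dist_triangle y P x
    have n2 := dist_triangle_right y x R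
    linarith
  have key := circle_ineq _ _ _ _ _ _ hs'.le hs.le hν dist_nonneg dist_nonneg
    (hPi Q (by rw [dist_comm Q P]; linarith)) (hPi S (by rw [dist_comm S P]; linarith))
    dist_nonneg (dist_triangle_right Q S x)
  rw [dist_comm Q P, cL] at hQ
  rw [dist_comm S P, cM] at hS
  have k1 := mul_le_mul_of_nonneg_left hQ hs'.le
  have k2 := mul_le_mul_of_nonneg_left hS hs.le
  refine le_of_mul_le_mul_left ?_ (mul_pos hs hs')
  linarith

theorem final_ineq (a b L M m : ℝ) (ha : 0 ≤ a) (hb : 0 ≤ b) (hm : 0 ≤ m)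
    (hL0 : 0 ≤ L) (hL : L < Real.pi) (hM0 : 0 ≤ M) (hM : M < Real.pi)
    (h : Real.cos a + Real.cos b + (Real.cos a + Real.cos b -
        4 * Real.sin (L / 2) * Real.sin (M / 2)) ≤
      4 * Real.cos (L / 2) * Real.cos (M / 2) * Real.cos m) :
    Real.cos (L / 2) ^ 2 * m ^ 2 + (1/4) * (M - L) ^ 2 ≤
      (1/2) * (a ^ 2 + b ^ 2) + 1 * ((a ^ 2 + b ^ 2 + (M - L) ^ 2 + m ^ 2) *
        (|a| + |b| + |M - L| + |m|)) := by
  rw [abs_of_nonneg ha, abs_of_nonneg hb, abs_of_nonneg hm]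
  have hδ0 := abs_nonneg (M - L)
  rw [← sq_abs (M - L)]
  have hc1 : Real.cos (L / 2) ≤ 1 := Real.cos_le_one _
  have hc0 : 0 ≤ Real.cos (L / 2) :=
    Real.cos_nonneg_of_neg_pi_div_two_le_of_le (by linarith) (by linarith)
  have hc1' : Real.cos (M / 2) ≤ 1 := Real.cos_le_one _
  have hc0' : 0 ≤ Real.cos (M / 2) :=
    Real.cos_nonneg_of_neg_pi_div_two_le_of_le (by linarith) (by linarith)
  have hcc : Real.cos (L / 2) ^ 2 ≤ 1 := by nlinarith
  rcases le_or_gt (a + b + |M - L| + m) 1 with hs | hs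
  · have hdiff : Real.cos (L / 2) - Real.cos (M / 2) ≤ |M - L| / 2 := by
      have := Real.abs_cos_sub_cos_le (L / 2) (M / 2)
      have h2 : |L / 2 - M / 2| = |M - L| / 2 := by
        rw [abs_sub_comm, ← sub_div, abs_div]; simp
      linarith [le_abs_self (Real.cos (L / 2) - Real.cos (M / 2))]
    have e1 := Real.one_sub_sq_div_two_le_cos (x := a)
    have e2 := Real.one_sub_sq_div_two_le_cos (x := b)
    have e3 := (abs_le.1 (Real.cos_bound (x := m) (by rw [abs_of_nonneg hm]; linarith))).2
    have e4 := (abs_le.1 (Real.cos_bound (x := |M - L| / 2) (by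
      rw [abs_of_nonneg (by positivity)]; linarith))).2
    rw [abs_of_nonneg hm] at e3
    rw [abs_of_nonneg (show 0 ≤ |M - L| / 2 by positivity)] at e4
    have e5 : Real.cos (|M - L| / 2) = Real.cos (L / 2) * Real.cos (M / 2) +
        Real.sin (L / 2) * Real.sin (M / 2) := by
      rw [← Real.cos_sub, ← Real.cos_abs (L / 2 - M / 2), abs_sub_comm, ← sub_div, abs_div]
      simp
    generalize |M - L| = d at *
    generalize Real.cos (L / 2) = c at *
    generalize Real.cos (M / 2) = c' at *
    have hp0 : 0 ≤ c * c' := mul_nonneg hc0 hc0'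
    have hp1 : c * c' ≤ 1 := mul_le_one₀ hc1 hc0' hc1'
    have f1 : c * c' * Real.cos m ≤ c * c' * (1 - m ^ 2 / 2 + m ^ 4 * (5 / 96)) :=
      mul_le_mul_of_nonneg_left (by linarith) hp0
    have m4 : m ^ 4 ≤ m ^ 3 := pow_le_pow_of_le_one hm (by linarith) (by norm_num)
    have d4 : d ^ 4 ≤ d ^ 3 := pow_le_pow_of_le_one hδ0 (by linarith) (by norm_num)
    have f2 : c * c' * m ^ 4 ≤ m ^ 3 :=
      (mul_le_of_le_one_left (by positivity) hp1).trans m4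
    have f3 : c ^ 2 * m ^ 2 ≤ c * c' * m ^ 2 + d / 2 * m ^ 2 := by
      have : c * (c - c') ≤ d / 2 := by nlinarith
      nlinarith [mul_le_mul_of_nonneg_right this (sq_nonneg m)]
    have f4 : m ^ 3 + d ^ 3 + d * m ^ 2 ≤ (a ^ 2 + b ^ 2 + d ^ 2 + m ^ 2) * (a + b + d + m) := by
      have : (a ^ 2 + b ^ 2 + d ^ 2 + m ^ 2) * (a + b + d + m) - (m ^ 3 + d ^ 3 + d * m ^ 2) =
        (a ^ 2 + b ^ 2) * (a + b + d + m) + (d ^ 2 + m ^ 2) * (a + b) + d ^ 2 * m := by ring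
      have : 0 ≤ (a ^ 2 + b ^ 2) * (a + b + d + m) + (d ^ 2 + m ^ 2) * (a + b) + d ^ 2 * m := by
        positivity
      linarith
    have g1 : 0 ≤ m ^ 3 := by positivity
    have g2 : 0 ≤ d ^ 3 := by positivity
    have g3 : 0 ≤ d * m ^ 2 := by positivity
    nlinarith
  · have h1 : Real.cos (L / 2) ^ 2 * m ^ 2 ≤ m ^ 2 := mul_le_of_le_one_left (by positivity) hcc
    have h2 : (a ^ 2 + b ^ 2 + |M - L| ^ 2 + m ^ 2) ≤
      (a ^ 2 + b ^ 2 + |M - L| ^ 2 + m ^ 2) * (a + b + |M - L| + m) :=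
      le_mul_of_one_le_right (by positivity) hs.le
    nlinarith [sq_nonneg a, sq_nonneg b, sq_nonneg |M - L|]

/-- (Serbinowski's ESTIMATE I) Quadrilateral comparison estimate for
midpoints of geodesics in a CAT(1) space, up to a cubic error term: there is a
universal constant bounding the error by a sum of degree-3 monomials (each with some
exponent ≥ 2) in the four indicated quantities. -/
theorem cat1_midpoint_estimate :
    ∃ C : ℝ, 0 < C ∧
      ∀ (Y : Type) [MetricSpace Y] [CompleteSpace Y], IsCAT 1 Y →
        ∀ γ η : ℝ → Y, IsGeodesic γ → IsGeodesic η →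
          dist (γ 0) (η 0) + dist (η 0) (η 1) + dist (η 1) (γ 1) + dist (γ 1) (γ 0) <
            2 * Real.pi →
          Real.cos (dist (γ 0) (γ 1) / 2) ^ 2 * dist (γ (1/2)) (η (1/2)) ^ 2 +
              (1/4) * (dist (η 0) (η 1) - dist (γ 0) (γ 1)) ^ 2 ≤
            (1/2) * (dist (γ 0) (η 0) ^ 2 + dist (γ 1) (η 1) ^ 2) +
              C * ((dist (γ 0) (η 0) ^ 2 + dist (γ 1) (η 1) ^ 2 +
                      (dist (η 0) (η 1) - dist (γ 0) (γ 1)) ^ 2 +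
                      dist (γ (1/2)) (η (1/2)) ^ 2) *
                    (|dist (γ 0) (η 0)| + |dist (γ 1) (η 1)| +
                      |dist (η 0) (η 1) - dist (γ 0) (γ 1)| +
                      |dist (γ (1/2)) (η (1/2))|)) := by
  refine ⟨1, one_pos, ?_⟩
  intro Y _ _ hY γ η hγ hη hper
  have n1 : 0 ≤ dist (γ 0) (η 0) := dist_nonneg
  have n2 : 0 ≤ dist (γ 1) (η 1) := dist_nonneg
  have n3 : 0 ≤ dist (γ 0) (γ 1) := dist_nonneg
  have n4 : 0 ≤ dist (η 0) (η 1) := dist_nonneg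
  have hq := cat_quad hY (γ 0) (γ 1) (η 1) (η 0) hper
  rw [dist_comm (η 1) (γ 1), dist_comm (γ 1) (γ 0)] at hper
  have a1 := dist_triangle (γ 0) (η 0) (η 1)
  have a2 := dist_triangle_right (γ 1) (η 0) (η 1)
  have a3 := dist_triangle_right (γ 0) (γ 1) (η 1)
  have a4 := dist_triangle_left (η 0) (η 1) (γ 0)
  have hLpi : dist (γ 0) (γ 1) < Real.pi := by linarith
  have a5 := dist_triangle (γ 0) (γ 1) (η 1)
  have hMpi : dist (η 0) (η 1) < Real.pi := by linarith
  have g0 : dist (γ 0) (γ (1/2)) = 1/2 * dist (γ 0) (γ 1) := by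
    rw [hγ 0 (by simp) (1/2) (by norm_num)]; norm_num
  have g1 : dist (γ 1) (γ (1/2)) = 1/2 * dist (γ 0) (γ 1) := by
    rw [hγ 1 (by simp) (1/2) (by norm_num)]; norm_num
  have a6 := dist_triangle_left (γ (1/2)) (η 0) (γ 0)
  have a7 := dist_triangle_left (γ (1/2)) (η 1) (γ 1)
  have h0 := cat_mid_s14 hY (γ (1/2)) η hη (by linarith)
  have h1 := cat_mid_s14 hY (η 0) γ hγ (by
    rw [dist_comm (η 0) (γ 0), dist_comm (η 0) (γ 1)]; linarith)
  have h2 := cat_mid_s14 hY (η 1) γ hγ (by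
    rw [dist_comm (η 1) (γ 0), dist_comm (η 1) (γ 1)]; linarith)
  rw [dist_comm (η 0) (γ 0), dist_comm (η 0) (γ 1), dist_comm (η 0) (γ (1/2))] at h1
  rw [dist_comm (η 1) (γ 0), dist_comm (η 1) (γ 1), dist_comm (η 1) (γ (1/2))] at h2
  have hc0 : 0 ≤ Real.cos (dist (γ 0) (γ 1) / 2) :=
    Real.cos_nonneg_of_neg_pi_div_two_le_of_le (by linarith) (by linarith)
  have h3 := mul_le_mul_of_nonneg_left h0 hc0
  exact final_ineq _ _ _ _ _ n1 n2 dist_nonneg n3 hLpi n4 hMpi (by linarith)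

end KSH
end
end
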